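/- arXiv:math/0211298 — 2 statements merged into one kernel-verified Lean document; each statement's English description precedes it below -/
import Mathlib

section
/- If X is a finite-dimensional real Banach space with dim X = n ≥ 3 which is not isometric to the Euclidean space ℓ₂^(n), then the set H(X) of isometry classes of finite-dimensional subspaces of X has cardinality exactly the continuum 𝔠 = 2^ω. -/
noncomputable section

universe u

/-- A packaged real Banach space. -/
structure BanachSpace : Type (u + 1) where
  carrier : Type u
  [norm : NormedAddCommGroup carrier]
  [smulR : NormedSpace ℝ carrier]
  [complete : CompleteSpace carrier]

attribute [instance] BanachSpace.norm BanachSpace.smulR BanachSpace.complete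

/-- A norm on `ℝ^n`. An `n`-dimensional real Banach space is (isometric to) `ℝ^n`
equipped with such a norm. -/
structure MNorm (n : ℕ) : Type where
  toFun : (Fin n → ℝ) → ℝ
  add_le' : ∀ x y, toFun (x + y) ≤ toFun x + toFun y
  smul_eq' : ∀ (a : ℝ) (x), toFun (a • x) = |a| * toFun x
  eq_zero' : ∀ x, toFun x = 0 → x = 0

/-- Two norms on `ℝ^n` are identified when they are linearly isometrically equivalent. -/
def mnormSetoid (n : ℕ) : Setoid (MNorm n) where
  r N₁ N₂ := ∃ e : (Fin n → ℝ) ≃ₗ[ℝ] (Fin n → ℝ), ∀ x, N₂.toFun (e x) = N₁.toFun x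
  iseqv := by
    constructor
    · exact fun N => ⟨LinearEquiv.refl ℝ _, fun x => rfl⟩
    · rintro N₁ N₂ ⟨e, he⟩
      refine ⟨e.symm, fun x => ?_⟩
      have h := he (e.symm x)
      rw [e.apply_symm_apply] at h
      exact h.symm
    · rintro N₁ N₂ N₃ ⟨e, he⟩ ⟨f, hf⟩
      exact ⟨e.trans f, fun x => by
        rw [LinearEquiv.trans_apply, hf, he]⟩

/-- The Minkowski compact `𝔐_n`: isometry classes of `n`-dimensional real Banach spaces. -/
def Mink (n : ℕ) : Type := Quotient (mnormSetoid n)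

/-- The Minkowski space `𝔐`: the disjoint union of the `𝔐_n`. -/
def MinkSpace : Type := Σ n : ℕ, Mink n

/-- The operator norm of a linear map `u : (ℝ^n, N₁) → (ℝ^n, N₂)`. -/
noncomputable def opC (n : ℕ) (N₁ N₂ : MNorm n)
    (u : (Fin n → ℝ) →ₗ[ℝ] (Fin n → ℝ)) : ℝ :=
  sInf {C : ℝ | 0 ≤ C ∧ ∀ x, N₂.toFun (u x) ≤ C * N₁.toFun x}

/-- The multiplicative Banach–Mazur distance between two norms on `ℝ^n`:
`inf {‖u‖·‖u⁻¹‖ : u a linear isomorphism}`. -/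
noncomputable def mDist (n : ℕ) (N₁ N₂ : MNorm n) : ℝ :=
  sInf {c : ℝ | ∃ u : (Fin n → ℝ) ≃ₗ[ℝ] (Fin n → ℝ),
    c = opC n N₁ N₂ u.toLinearMap * opC n N₂ N₁ u.symm.toLinearMap}

/-- The Banach–Mazur metric `log d` on `𝔐_n`. -/
noncomputable def minkDist (n : ℕ) (P Q : Mink n) : ℝ :=
  Real.log (mDist n P.out Q.out)

/-- The topology of the Banach–Mazur metric on `𝔐_n` (generated by its open balls). -/
instance minkTopology (n : ℕ) : TopologicalSpace (Mink n) :=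
  TopologicalSpace.generateFrom
    {s : Set (Mink n) | ∃ (P : Mink n) (ε : ℝ), 0 < ε ∧ s = {Q | minkDist n P Q < ε}}

instance : TopologicalSpace MinkSpace := by
  unfold MinkSpace; infer_instance

/-- The class in `𝔐` determined by a norm on `ℝ^n`. -/
def minkClass {n : ℕ} (N : MNorm n) : MinkSpace := ⟨n, Quotient.mk (mnormSetoid n) N⟩

/-- `H(X) ⊆ 𝔐`: the set of isometry classes of finite-dimensional subspaces of `X`.
A class `c` belongs to `H(X)` iff `ℝ^{c.1}` with (a representative of) the norm class `c.2`
embeds linearly isometrically into `X`. -/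
def HSet (X : Type u) [SeminormedAddCommGroup X] [NormedSpace ℝ X] : Set MinkSpace :=
  {c : MinkSpace | ∃ f : (Fin c.1 → ℝ) →ₗ[ℝ] X, Function.Injective f ∧
    ∀ v, ‖f v‖ = (Quotient.out c.2).toFun v}

/-- `H_m(X) ⊆ 𝔐_m`: the set of isometry classes of `m`-dimensional subspaces of `X`. -/
def HmSet (m : ℕ) (X : Type u) [SeminormedAddCommGroup X] [NormedSpace ℝ X] : Set (Mink m) :=
  {P : Mink m | ∃ f : (Fin m → ℝ) →ₗ[ℝ] X, Function.Injective f ∧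
    ∀ v, ‖f v‖ = (Quotient.out P).toFun v}


open MeasureTheory

/-- A nonvanishing continuous function on the plane has winding number zero along the unit circle. -/
theorem not_forall_circle_eq_exp_mul {F : ℂ → ℂ} (hF : Continuous F) (h0 : ∀ z, F z ≠ 0)
    {k : ℤ} (hk : k ≠ 0) :
    ¬ ∀ t : ℝ, F (Complex.exp (t * Complex.I)) = Complex.exp (k * t * Complex.I) * F 1 := by
  intro h
  obtain ⟨L, ⟨-, hL⟩, -⟩ := Complex.isCoveringMapOn_exp.existsUnique_continuousMap_lifts
    ⟨F, hF⟩ (a₀ := (0 : ℂ)) (Complex.exp_log (h0 0)) (fun x => h0 x)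
  have hL' : ∀ z, Complex.exp (L z) = F z := fun z => congrFun hL z
  let g : ℝ → ℂ := fun t => L (Complex.exp (t * Complex.I)) - k * t * Complex.I
  have hg : Continuous g := by
    have := L.continuous
    fun_prop
  have hge : ∀ t, Complex.exp (g t) = F 1 := by
    intro t
    simp only [g, Complex.exp_sub, hL', h]
    field_simp [Complex.exp_ne_zero]
  have key := Complex.isCoveringMap_exp.const_of_comp hg
    (fun a a' => Subtype.ext ((hge a).trans (hge a').symm)) 0 (2 * Real.pi)
  have e2 : Complex.exp (((2 * Real.pi : ℝ) : ℂ) * Complex.I) = 1 := by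
    push_cast; exact Complex.exp_two_pi_mul_I
  simp only [g, e2] at key
  have h1 : (k : ℂ) * (2 * Real.pi) * Complex.I = 0 := by
    have : L 1 = L 1 - k * (2 * Real.pi) * Complex.I := by simpa using key
    linear_combination this
  simp [Real.pi_ne_zero, hk] at h1

/-- The point of the unit circle at angle `θ`. -/
def circ (θ : ℝ) : Fin 2 → ℝ := ![Real.cos θ, Real.sin θ]

theorem continuous_circ : Continuous circ := by
  unfold circ
  refine continuous_pi fun i => ?_
  fin_cases i
  · exact Real.continuous_cos
  · exact Real.continuous_sin

theorem circ_add_two_pi (θ : ℝ) : circ (θ + 2 * Real.pi) = circ θ := by simp [circ]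

theorem circ_ne_zero (θ : ℝ) : circ θ ≠ 0 := by
  intro h
  have h0 : Real.cos θ = 0 := congrFun h 0
  have h1 : Real.sin θ = 0 := congrFun h 1
  simpa [h0, h1] using Real.sin_sq_add_cos_sq θ

/-- The Fourier integral of a real function over one period. -/
def fourierInt (h : ℝ → ℝ) (m : ℤ) : ℂ :=
  ∫ θ in (0 : ℝ)..(2 * Real.pi), (h θ : ℂ) * Complex.exp (-(m * θ * Complex.I))

theorem exp_periodic (m : ℤ) :
    Function.Periodic (fun θ : ℝ => Complex.exp (-(m * θ * Complex.I))) (2 * Real.pi) := by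
  intro θ
  have : -((m : ℂ) * ((θ + 2 * Real.pi : ℝ) : ℂ) * Complex.I)
      = -(m * θ * Complex.I) + ((-m : ℤ) : ℂ) * (2 * Real.pi * Complex.I) := by
    push_cast; ring
  simp only
  rw [this, Complex.exp_add, Complex.exp_int_mul_two_pi_mul_I, mul_one]

theorem fourierInt_shift {h : ℝ → ℝ} (hp : Function.Periodic h (2 * Real.pi)) (m : ℤ) (φ : ℝ) :
    fourierInt (fun θ => h (θ + φ)) m = Complex.exp (m * φ * Complex.I) * fourierInt h m := by
  unfold fourierInt
  have hq : Function.Periodic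
      (fun θ : ℝ => (h θ : ℂ) * Complex.exp (-(m * θ * Complex.I))) (2 * Real.pi) := by
    intro θ
    have := exp_periodic m θ
    simp only at this ⊢
    rw [hp, this]
  have h1 := intervalIntegral.integral_comp_add_right (a := 0) (b := 2 * Real.pi)
    (fun θ : ℝ => (h θ : ℂ) * Complex.exp (-(m * θ * Complex.I))) φ
  have h2 := hq.intervalIntegral_add_eq φ 0
  rw [zero_add] at h1 h2
  rw [← h2, add_comm φ, ← h1, ← intervalIntegral.integral_const_mul]
  refine intervalIntegral.integral_congr fun θ _ => ?_
  simp only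
  rw [mul_left_comm, ← Complex.exp_add]
  congr 2
  push_cast; ring

theorem fourierInt_neg {h : ℝ → ℝ} (hp : Function.Periodic h (2 * Real.pi)) (m : ℤ) :
    fourierInt (fun θ => h (-θ)) m = (starRingEnd ℂ) (fourierInt h m) := by
  unfold fourierInt
  have hq : Function.Periodic
      (fun θ : ℝ => (starRingEnd ℂ) ((h θ : ℂ) * Complex.exp (-(m * θ * Complex.I))))
      (2 * Real.pi) := by
    intro θ
    have := exp_periodic m θ
    simp only at this ⊢
    rw [hp, this]
  rw [← intervalIntegral.intervalIntegral_conj]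
  have h1 := intervalIntegral.integral_comp_neg (a := 0) (b := 2 * Real.pi)
    (fun θ : ℝ => (starRingEnd ℂ) ((h θ : ℂ) * Complex.exp (-(m * θ * Complex.I))))
  have h2 := hq.intervalIntegral_add_eq (-(2 * Real.pi)) 0
  rw [neg_add_cancel, zero_add] at h2
  rw [neg_zero] at h1
  rw [← h2, ← h1]
  refine intervalIntegral.integral_congr fun θ _ => ?_
  simp only [map_mul, Complex.conj_ofReal, ← Complex.exp_conj]
  congr 2
  simp

theorem fourierInt_const_mul (h : ℝ → ℝ) (k : ℝ) (m : ℤ) :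
    fourierInt (fun θ => k * h θ) m = k * fourierInt h m := by
  unfold fourierInt
  rw [← intervalIntegral.integral_const_mul]
  refine intervalIntegral.integral_congr fun θ _ => ?_
  simp only
  push_cast; ring

theorem fourierInt_zero_ne_zero {h : ℝ → ℝ} (hc : Continuous h) (hpos : ∀ θ, 0 < h θ) :
    fourierInt h 0 ≠ 0 := by
  have : fourierInt h 0 = ((∫ θ in (0 : ℝ)..(2 * Real.pi), h θ : ℝ) : ℂ) := by
    unfold fourierInt
    rw [← intervalIntegral.integral_ofReal]
    simp
  rw [this]
  exact_mod_cast (intervalIntegral.intervalIntegral_pos_of_pos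
    (hc.intervalIntegrable _ _) hpos Real.two_pi_pos).ne'

theorem const_of_fourierInt_eq_zero {h : ℝ → ℝ} (hc : Continuous h)
    (hp : Function.Periodic h (2 * Real.pi)) (h0 : ∀ m : ℤ, m ≠ 0 → fourierInt h m = 0)
    (θ : ℝ) : h θ = h 0 := by
  have : Fact (0 < 2 * Real.pi) := ⟨Real.two_pi_pos⟩
  have hp' : Function.Periodic (fun θ => (h θ : ℂ)) (2 * Real.pi) := fun θ => by
    simp only [hp θ]
  let f : C(AddCircle (2 * Real.pi), ℂ) := ⟨hp'.lift, by
    refine continuous_coinduced_dom.mpr ?_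
    exact Complex.continuous_ofReal.comp hc⟩
  have hf : ∀ x : ℝ, f (x : AddCircle (2 * Real.pi)) = h x := fun x => hp'.lift_coe x
  have hz : ∀ m : ℤ, m ≠ 0 → fourierCoeff f m = 0 := by
    intro m hm
    rw [fourierCoeff_eq_intervalIntegral f m 0, zero_add]
    have e := h0 m hm
    unfold fourierInt at e
    rw [smul_eq_zero]
    right
    rw [← e]
    refine intervalIntegral.integral_congr fun x _ => ?_
    simp only [fourier_coe_apply, hf, smul_eq_mul]
    rw [mul_comm]
    congr 2
    have : (Real.pi : ℂ) ≠ 0 := by exact_mod_cast Real.pi_ne_zero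
    push_cast
    field_simp
  have hs : Summable (fourierCoeff f) := summable_of_ne_finset_zero (s := {0}) (by
    intro b hb
    exact hz b (by simpa using hb))
  have key : ∀ x : AddCircle (2 * Real.pi), f x = fourierCoeff f 0 := by
    intro x
    have h1 := has_pointwise_sum_fourier_series_of_summable hs x
    have h2 := hasSum_single (f := fun i => fourierCoeff f i • fourier i x) 0 (by
      intro b hb
      simp [hz b hb])
    have := h1.unique h2
    simpa using this
  have := (hf θ).symm.trans ((key θ).trans ((key (0 : ℝ)).symm.trans (hf 0)))
  exact_mod_cast this


open Matrix

/-- A norm on the plane, bounded below by a positive multiple of the sup norm. -/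
structure IsPlaneNorm (N : (Fin 2 → ℝ) → ℝ) (c : ℝ) : Prop where
  cont : Continuous N
  pos : 0 < c
  le : ∀ x, c * ‖x‖ ≤ N x
  smul : ∀ (a : ℝ) x, N (a • x) = |a| * N x

/-- The tent weight supported on the unit ball of `N`. -/
def tent (N : (Fin 2 → ℝ) → ℝ) (x : Fin 2 → ℝ) : ℝ := max 0 (1 - N x)

theorem tent_nonneg (N : (Fin 2 → ℝ) → ℝ) (x : Fin 2 → ℝ) : 0 ≤ tent N x := le_max_left _ _

/-- The matrix of second moments of `tent N`. -/
def moment (N : (Fin 2 → ℝ) → ℝ) : Matrix (Fin 2) (Fin 2) ℝ :=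
  Matrix.of fun i j => ∫ x, tent N x * (x i * x j)

theorem moment_symm (N : (Fin 2 → ℝ) → ℝ) : moment N 1 0 = moment N 0 1 := by
  simp only [moment, Matrix.of_apply]
  simp_rw [mul_comm]

namespace IsPlaneNorm

variable {N : (Fin 2 → ℝ) → ℝ} {c : ℝ}

theorem apply_nonneg (h : IsPlaneNorm N c) (x : Fin 2 → ℝ) : 0 ≤ N x :=
  (mul_nonneg h.pos.le (norm_nonneg x)).trans (h.le x)

theorem apply_pos (h : IsPlaneNorm N c) {x : Fin 2 → ℝ} (hx : x ≠ 0) : 0 < N x :=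
  (mul_pos h.pos (norm_pos_iff.2 hx)).trans_le (h.le x)

theorem tent_eq_zero (hc : 0 < c) (hle : ∀ x, c * ‖x‖ ≤ N x) {x : Fin 2 → ℝ}
    (hx : x ∉ Metric.closedBall (0 : Fin 2 → ℝ) c⁻¹) : tent N x = 0 := by
  rw [mem_closedBall_zero_iff, not_le, inv_lt_iff_one_lt_mul₀' hc] at hx
  exact max_eq_left (by linarith [hle x])

theorem continuous_tent (h : IsPlaneNorm N c) : Continuous (tent N) :=
  continuous_const.max (continuous_const.sub h.cont)

theorem hasCompactSupport_mul (h : IsPlaneNorm N c) (f : (Fin 2 → ℝ) → ℝ) :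
    HasCompactSupport fun x => tent N x * f x :=
  HasCompactSupport.intro (isCompact_closedBall (0 : Fin 2 → ℝ) c⁻¹) fun x hx => by
    rw [tent_eq_zero h.pos h.le hx, zero_mul]

theorem integrable_mul (h : IsPlaneNorm N c) {f : (Fin 2 → ℝ) → ℝ} (hf : Continuous f) :
    Integrable fun x => tent N x * f x :=
  (h.continuous_tent.mul hf).integrable_of_hasCompactSupport (h.hasCompactSupport_mul f)

theorem moment_quadratic (h : IsPlaneNorm N c) (a b : ℝ) :
    ∫ x, tent N x * (a * x 0 + b * x 1) ^ 2 =
      a ^ 2 * moment N 0 0 + 2 * a * b * moment N 0 1 + b ^ 2 * moment N 1 1 := by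
  have i00 := (h.integrable_mul (f := fun x => x 0 * x 0) (by fun_prop)).const_mul (a ^ 2)
  have i01 := (h.integrable_mul (f := fun x => x 0 * x 1) (by fun_prop)).const_mul (2 * a * b)
  have i11 := (h.integrable_mul (f := fun x => x 1 * x 1) (by fun_prop)).const_mul (b ^ 2)
  have i0 : Integrable fun x : Fin 2 → ℝ => a ^ 2 * (tent N x * (x 0 * x 0)) +
    2 * a * b * (tent N x * (x 0 * x 1)) := i00.add i01
  simp only [moment, Matrix.of_apply]
  rw [← integral_const_mul, ← integral_const_mul, ← integral_const_mul,
    ← integral_add i00 i01, ← integral_add i0 i11]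
  refine integral_congr_ae (.of_forall fun x => ?_)
  simp only
  ring

theorem moment_quadratic_pos (h : IsPlaneNorm N c) {a b : ℝ} (hab : a ^ 2 + b ^ 2 ≠ 0) :
    0 < a ^ 2 * moment N 0 0 + 2 * a * b * moment N 0 1 + b ^ 2 * moment N 1 1 := by
  rw [← h.moment_quadratic]
  set v : Fin 2 → ℝ := ![a, b]
  set t : ℝ := (N v + 1)⁻¹
  have hv := h.apply_nonneg v
  have ht : 0 < t := by positivity
  refine Continuous.integral_pos_of_hasCompactSupport_nonneg_nonzero (x := t • v)
    (h.continuous_tent.mul (by fun_prop)) (h.hasCompactSupport_mul _)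
    (fun x => mul_nonneg (tent_nonneg N x) (sq_nonneg _)) ?_
  have h1 : N (t • v) < 1 := by
    rw [h.smul, abs_of_pos ht, inv_mul_lt_iff₀ (by positivity)]
    linarith
  have h2 : tent N (t • v) ≠ 0 := (lt_max_of_lt_right (by linarith)).ne'
  refine mul_ne_zero h2 (pow_ne_zero 2 ?_)
  have : a * (t • v) 0 + b * (t • v) 1 = t * (a ^ 2 + b ^ 2) := by
    simp [v]; ring
  rw [this]
  exact mul_ne_zero ht.ne' hab

theorem moment_zero_zero_pos (h : IsPlaneNorm N c) : 0 < moment N 0 0 := by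
  simpa using h.moment_quadratic_pos (a := 1) (b := 0) (by norm_num)

theorem moment_one_one_pos (h : IsPlaneNorm N c) : 0 < moment N 1 1 := by
  simpa using h.moment_quadratic_pos (a := 0) (b := 1) (by norm_num)

theorem moment_trace_pos (h : IsPlaneNorm N c) : 0 < (moment N).trace := by
  rw [Matrix.trace_fin_two]
  exact add_pos h.moment_zero_zero_pos h.moment_one_one_pos

theorem moment_det_pos (h : IsPlaneNorm N c) : 0 < (moment N).det := by
  have h0 := h.moment_zero_zero_pos
  have h1 := h.moment_quadratic_pos (a := -moment N 0 1) (b := moment N 0 0) (by positivity)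
  rw [Matrix.det_fin_two, moment_symm]
  refine pos_of_mul_pos_right (a := moment N 0 0) ?_ h0.le
  nlinarith

theorem comp_mulVec (h : IsPlaneNorm N c) {A : Matrix (Fin 2) (Fin 2) ℝ} (hA : A.det ≠ 0) :
    ∃ c', IsPlaneNorm (fun x => N (A *ᵥ x)) c' := by
  have hinj : Function.Injective (Matrix.toLin' A) := by
    have := Matrix.mulVec_injective_of_isUnit
      ((Matrix.isUnit_iff_isUnit_det A).2 (isUnit_iff_ne_zero.2 hA))
    simpa [Function.Injective] using this
  obtain ⟨K, hK, hA'⟩ := (Matrix.toLin' A).exists_antilipschitzWith (LinearMap.ker_eq_bot.2 hinj)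
  have hK' : (0 : ℝ) < K := hK
  refine ⟨c / K, h.cont.comp (by fun_prop), div_pos h.pos hK', fun x => ?_, fun a x => ?_⟩
  · have h1 : ‖x‖ ≤ K * ‖A *ᵥ x‖ := by
      have := hA'.le_mul_dist x 0
      simpa using this
    calc c / K * ‖x‖ ≤ c / K * (K * ‖A *ᵥ x‖) := by
          have := div_pos h.pos hK'
          gcongr
      _ = c * ‖A *ᵥ x‖ := by field_simp
      _ ≤ _ := h.le _
  · rw [Matrix.mulVec_smul, h.smul]

theorem moment_comp (h : IsPlaneNorm N c) {A : Matrix (Fin 2) (Fin 2) ℝ} (hA : A.det ≠ 0) :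
    A * moment (fun x => N (A *ᵥ x)) * Aᵀ = |A.det⁻¹| • moment N := by
  obtain ⟨c', h'⟩ := h.comp_mulVec hA
  ext i j
  have cov : ∫ x, tent N (A *ᵥ x) * ((A *ᵥ x) i * (A *ᵥ x) j) =
      |A.det⁻¹| * ∫ y, tent N y * (y i * y j) := by
    have hg : Continuous fun y : Fin 2 → ℝ => tent N y * (y i * y j) :=
      h.continuous_tent.mul (by fun_prop)
    have h1 := integral_map (μ := volume) (φ := Matrix.toLin' A)
      (LinearMap.continuous_of_finiteDimensional _).measurable.aemeasurable
      (hg.aestronglyMeasurable)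
    rw [Real.map_matrix_volume_pi_eq_smul_volume_pi hA, integral_smul_measure,
      ENNReal.toReal_ofReal (abs_nonneg _)] at h1
    simpa using h1.symm
  have hInt : ∀ k l : Fin 2, Integrable fun x : Fin 2 → ℝ =>
      tent (fun x => N (A *ᵥ x)) x * (x k * x l) :=
    fun k l => h'.integrable_mul (by fun_prop)
  have expand : ∫ x, tent N (A *ᵥ x) * ((A *ᵥ x) i * (A *ᵥ x) j) =
      ∑ k, ∑ l, A i k * A j l * moment (fun x => N (A *ᵥ x)) k l := by
    simp only [moment, Matrix.of_apply, ← integral_const_mul]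
    rw [Finset.sum_congr rfl fun k _ => (integral_finsetSum _ fun l _ =>
      (hInt k l).const_mul _).symm]
    rw [← integral_finsetSum _ fun k _ => integrable_finsetSum _ fun l _ =>
      (hInt k l).const_mul _]
    refine integral_congr_ae (.of_forall fun x => ?_)
    simp only [tent, Matrix.mulVec, dotProduct, Fin.sum_univ_two]
    ring
  rw [Matrix.smul_apply, smul_eq_mul, show moment N i j = ∫ y, tent N y * (y i * y j) from rfl,
    ← cov, expand]
  simp only [Matrix.mul_apply, Matrix.transpose_apply, Fin.sum_univ_two]
  ring

end IsPlaneNorm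

/-- A matrix proportional to the positive square root of the moment matrix. -/
def sqrtMoment (N : (Fin 2 → ℝ) → ℝ) : Matrix (Fin 2) (Fin 2) ℝ :=
  moment N + √(moment N).det • 1

theorem sqrtMoment_transpose (N : (Fin 2 → ℝ) → ℝ) : (sqrtMoment N)ᵀ = sqrtMoment N := by
  have hM : (moment N)ᵀ = moment N := by
    ext i j
    fin_cases i <;> fin_cases j <;> simp [moment_symm]
  simp [sqrtMoment, hM]

namespace IsPlaneNorm

variable {N : (Fin 2 → ℝ) → ℝ} {c : ℝ}

theorem sqrtMoment_mul_self (h : IsPlaneNorm N c) :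
    sqrtMoment N * sqrtMoment N =
      ((moment N).trace + 2 * √(moment N).det) • moment N := by
  have hd := Real.mul_self_sqrt h.moment_det_pos.le
  unfold sqrtMoment
  set δ := √(moment N).det
  rw [Matrix.det_fin_two] at hd
  rw [Matrix.trace_fin_two]
  ext i j
  fin_cases i <;> fin_cases j <;>
    simp [Matrix.mul_apply, Fin.sum_univ_two] <;>
    first | ring1 | linear_combination hd

theorem sqrtMoment_det_pos (h : IsPlaneNorm N c) : 0 < (sqrtMoment N).det := by
  have hd := h.moment_det_pos
  have hδ := Real.sqrt_pos.2 hd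
  have ht := h.moment_trace_pos
  have : (sqrtMoment N).det = (moment N).det + √(moment N).det * (moment N).trace
      + √(moment N).det ^ 2 := by
    unfold sqrtMoment
    set δ := √(moment N).det
    rw [Matrix.det_fin_two, Matrix.det_fin_two, Matrix.trace_fin_two]
    simp
    ring
  rw [this]
  positivity

end IsPlaneNorm


/-- The restriction to the unit circle of the norm `N` in its normalized position. -/
def profile (N : (Fin 2 → ℝ) → ℝ) (θ : ℝ) : ℝ := N (sqrtMoment N *ᵥ circ θ)

theorem profile_periodic (N : (Fin 2 → ℝ) → ℝ) :
    Function.Periodic (profile N) (2 * Real.pi) := fun θ => by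
  rw [profile, circ_add_two_pi, profile]

/-- The Fourier coefficients of the normalized norm, up to a constant factor. -/
def coeff (N : (Fin 2 → ℝ) → ℝ) (m : ℤ) : ℂ := fourierInt (profile N) m

/-- An isometry invariant of planar norms. -/
def coeffRatio (N : (Fin 2 → ℝ) → ℝ) (m : ℤ) : ℝ := ‖coeff N m‖ / ‖coeff N 0‖

theorem norm_exp_int_mul (m : ℤ) (φ : ℝ) : ‖Complex.exp (m * φ * Complex.I)‖ = 1 := by
  exact_mod_cast Complex.norm_exp_ofReal_mul_I (m * φ)

/-- The matrix of the rotation by the angle `φ`. -/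
def rotMat (φ : ℝ) : Matrix (Fin 2) (Fin 2) ℝ :=
  !![Real.cos φ, -Real.sin φ; Real.sin φ, Real.cos φ]

theorem rotMat_mulVec_circ (φ θ : ℝ) : rotMat φ *ᵥ circ θ = circ (θ + φ) := by
  ext i
  fin_cases i <;>
    simp [rotMat, circ, Matrix.mulVec, dotProduct, Fin.sum_univ_two, Real.cos_add,
      Real.sin_add] <;> ring

theorem rotMat_mul_transpose (φ : ℝ) : rotMat φ * (rotMat φ)ᵀ = 1 := by
  have := Real.sin_sq_add_cos_sq φ
  ext i j
  fin_cases i <;> fin_cases j <;>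
    simp [rotMat, Matrix.mul_apply, Fin.sum_univ_two] <;> first | ring1 | linear_combination this

theorem rotMat_det (φ : ℝ) : (rotMat φ).det = 1 := by
  have := Real.sin_sq_add_cos_sq φ
  simp [rotMat, Matrix.det_fin_two]
  linear_combination this

theorem exists_angle_of_orthogonal {U : Matrix (Fin 2) (Fin 2) ℝ} (hU : U * Uᵀ = 1) :
    ∃ φ, (∀ θ, U *ᵥ circ θ = circ (θ + φ)) ∨ (∀ θ, U *ᵥ circ θ = circ (-θ + φ)) := by
  have hU' : Uᵀ * U = 1 := mul_eq_one_comm.1 hU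
  have e00 : U 0 0 ^ 2 + U 1 0 ^ 2 = 1 := by
    have := congrFun (congrFun hU' 0) 0
    simp [Matrix.mul_apply, Fin.sum_univ_two] at this
    linarith
  have e11 : U 0 1 ^ 2 + U 1 1 ^ 2 = 1 := by
    have := congrFun (congrFun hU' 1) 1
    simp [Matrix.mul_apply, Fin.sum_univ_two] at this
    linarith
  have e01 : U 0 0 * U 0 1 + U 1 0 * U 1 1 = 0 := by
    have := congrFun (congrFun hU' 0) 1
    simpa [Matrix.mul_apply, Fin.sum_univ_two] using this
  let z : ℂ := ⟨U 0 0, U 1 0⟩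
  have hz : ‖z‖ = 1 := by
    rw [← sq_eq_sq₀ (norm_nonneg _) zero_le_one, Complex.sq_norm, Complex.normSq_apply]
    simp only [z]; linarith
  have hz0 : z ≠ 0 := by
    intro h; simp [h] at hz
  have hcos : Real.cos z.arg = U 0 0 := by rw [Complex.cos_arg hz0, hz, div_one]
  have hsin : Real.sin z.arg = U 1 0 := by rw [Complex.sin_arg, hz, div_one]
  have hd : (U 0 0 * U 1 1 - U 1 0 * U 0 1) ^ 2 = 1 := by
    linear_combination U 0 1 ^ 2 * e00 + U 1 1 ^ 2 * e00 + e11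
      - (U 0 0 * U 0 1 + U 1 0 * U 1 1) * e01
  refine ⟨z.arg, ?_⟩
  rcases eq_or_eq_neg_of_sq_eq_sq _ _ (hd.trans (one_pow 2).symm) with hd | hd
  · left
    have h1 : U 1 1 = U 0 0 := by
      linear_combination U 0 0 * hd - U 1 1 * e00 + U 1 0 * e01
    have h2 : U 0 1 = - U 1 0 := by
      linear_combination (-U 1 0) * hd - U 0 1 * e00 + U 0 0 * e01
    intro θ
    ext i
    fin_cases i <;>
      simp [circ, Matrix.mulVec, dotProduct, Fin.sum_univ_two, Real.cos_add,
        Real.sin_add, hcos, hsin, h1, h2] <;> ring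
  · right
    have h1 : U 1 1 = - U 0 0 := by
      linear_combination U 0 0 * hd - U 1 1 * e00 + U 1 0 * e01
    have h2 : U 0 1 = U 1 0 := by
      linear_combination (-U 1 0) * hd - U 0 1 * e00 + U 0 0 * e01
    intro θ
    ext i
    fin_cases i <;>
      simp [circ, Matrix.mulVec, dotProduct, Fin.sum_univ_two, Real.cos_add,
        Real.sin_add, hcos, hsin, h1, h2] <;> ring

namespace IsPlaneNorm

variable {N : (Fin 2 → ℝ) → ℝ} {c : ℝ}

theorem profile_continuous (h : IsPlaneNorm N c) : Continuous (profile N) :=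
  h.cont.comp (continuous_const.matrix_mulVec continuous_circ)

theorem sqrtMoment_mulVec_ne_zero (h : IsPlaneNorm N c) {x : Fin 2 → ℝ} (hx : x ≠ 0) :
    sqrtMoment N *ᵥ x ≠ 0 := fun h0 =>
  hx (Matrix.eq_zero_of_mulVec_eq_zero h.sqrtMoment_det_pos.ne' h0)

theorem profile_pos (h : IsPlaneNorm N c) (θ : ℝ) : 0 < profile N θ :=
  h.apply_pos (h.sqrtMoment_mulVec_ne_zero (circ_ne_zero θ))

theorem coeff_zero_ne_zero (h : IsPlaneNorm N c) : coeff N 0 ≠ 0 :=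
  fourierInt_zero_ne_zero h.profile_continuous h.profile_pos

theorem exists_orthogonal_sqrtMoment_comp (h : IsPlaneNorm N c)
    {A : Matrix (Fin 2) (Fin 2) ℝ} (hA : A.det ≠ 0) :
    ∃ k : ℝ, 0 < k ∧ ∃ U : Matrix (Fin 2) (Fin 2) ℝ, U * Uᵀ = 1 ∧
      A * sqrtMoment (fun x => N (A *ᵥ x)) = k • (sqrtMoment N * U) := by
  obtain ⟨c', h'⟩ := h.comp_mulVec hA
  set N' := fun x => N (A *ᵥ x)
  set S := sqrtMoment N
  set S' := sqrtMoment N'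
  have hS : IsUnit S.det := isUnit_iff_ne_zero.2 h.sqrtMoment_det_pos.ne'
  have hSt : Sᵀ = S := sqrtMoment_transpose N
  have hSt' : S'ᵀ = S' := sqrtMoment_transpose N'
  set τ := (moment N).trace + 2 * √(moment N).det
  set τ' := (moment N').trace + 2 * √(moment N').det
  have hτ : 0 < τ := add_pos_of_pos_of_nonneg h.moment_trace_pos (by positivity)
  have hτ' : 0 < τ' := add_pos_of_pos_of_nonneg h'.moment_trace_pos (by positivity)
  have hd : 0 < |A.det⁻¹| := abs_pos.2 (inv_ne_zero hA)
  set k := √(τ' * |A.det⁻¹| / τ)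
  have hk : 0 < k := Real.sqrt_pos.2 (by positivity)
  have hk2 : k * k = τ' * |A.det⁻¹| / τ := Real.mul_self_sqrt (by positivity)
  have hASA : A * S' * (A * S')ᵀ = (k * k) • (S * S) := by
    rw [Matrix.transpose_mul, hSt']
    calc A * S' * (S' * Aᵀ) = A * (S' * S') * Aᵀ := by simp only [Matrix.mul_assoc]
      _ = τ' • (A * moment N' * Aᵀ) := by
        rw [h'.sqrtMoment_mul_self]; simp [τ']
      _ = _ := by
        rw [h.moment_comp hA, h.sqrtMoment_mul_self, hk2, smul_smul, smul_smul]
        congr 1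
        field_simp
        rfl
  refine ⟨k, hk, k⁻¹ • (S⁻¹ * (A * S')), ?_, ?_⟩
  · rw [Matrix.transpose_smul, Matrix.transpose_mul, Matrix.transpose_nonsing_inv, hSt,
      Matrix.smul_mul, Matrix.mul_smul, smul_smul]
    calc (k⁻¹ * k⁻¹) • (S⁻¹ * (A * S') * ((A * S')ᵀ * S⁻¹))
        = (k⁻¹ * k⁻¹) • (S⁻¹ * (A * S' * (A * S')ᵀ) * S⁻¹) := by simp only [Matrix.mul_assoc]
      _ = ((k⁻¹ * k⁻¹) * (k * k)) • ((S⁻¹ * S) * (S * S⁻¹)) := by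
        rw [hASA]
        simp only [Matrix.mul_smul, Matrix.smul_mul, smul_smul, Matrix.mul_assoc]
      _ = 1 := by
        rw [Matrix.nonsing_inv_mul _ hS, Matrix.mul_nonsing_inv _ hS, mul_one]
        have : (k⁻¹ * k⁻¹) * (k * k) = 1 := by field_simp
        rw [this, one_smul]
  · rw [Matrix.mul_smul, smul_smul, mul_inv_cancel₀ hk.ne', one_smul, ← Matrix.mul_assoc,
      Matrix.mul_nonsing_inv _ hS, Matrix.one_mul]

theorem coeffRatio_comp (h : IsPlaneNorm N c) {A : Matrix (Fin 2) (Fin 2) ℝ} (hA : A.det ≠ 0)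
    (m : ℤ) : coeffRatio (fun x => N (A *ᵥ x)) m = coeffRatio N m := by
  obtain ⟨k, hk, U, hU, hS⟩ := h.exists_orthogonal_sqrtMoment_comp hA
  have hprof : ∀ θ, profile (fun x => N (A *ᵥ x)) θ = k * N (sqrtMoment N *ᵥ (U *ᵥ circ θ)) := by
    intro θ
    rw [profile, Matrix.mulVec_mulVec, hS, Matrix.smul_mulVec, h.smul, abs_of_pos hk,
      Matrix.mulVec_mulVec]
  have key : ∀ n, ‖coeff (fun x => N (A *ᵥ x)) n‖ = k * ‖coeff N n‖ := by
    intro n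
    obtain ⟨φ, hφ | hφ⟩ := exists_angle_of_orthogonal hU
    · have : profile (fun x => N (A *ᵥ x)) = fun θ => k * profile N (θ + φ) := by
        funext θ; rw [hprof, hφ, profile]
      rw [coeff, this, fourierInt_const_mul fun θ => profile N (θ + φ),
        fourierInt_shift (profile_periodic N), norm_mul, norm_mul, norm_exp_int_mul,
        one_mul, Complex.norm_of_nonneg hk.le, coeff]
    · have : profile (fun x => N (A *ᵥ x)) = fun θ => k * profile N (-θ + φ) := by
        funext θ; rw [hprof, hφ, profile]
      have hp : Function.Periodic (fun θ => profile N (θ + φ)) (2 * Real.pi) := fun θ => by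
        simp only [add_right_comm θ, profile_periodic N (θ + φ)]
      rw [coeff, this, fourierInt_const_mul fun θ => profile N (-θ + φ), fourierInt_neg hp,
        fourierInt_shift (profile_periodic N), norm_mul, RCLike.norm_conj, norm_mul,
        norm_exp_int_mul, one_mul, Complex.norm_of_nonneg hk.le, coeff]
  rw [coeffRatio, key, key, mul_div_mul_left _ _ hk.ne', coeffRatio]

theorem coeff_comp_rotMat (h : IsPlaneNorm N c) (φ : ℝ) (m : ℤ) :
    coeff (fun x => N (rotMat φ *ᵥ x)) m = Complex.exp (m * φ * Complex.I) * coeff N m := by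
  have hdet : (rotMat φ).det ≠ 0 := by rw [rotMat_det]; exact one_ne_zero
  have hR := rotMat_mul_transpose φ
  have hR' : (rotMat φ)ᵀ * rotMat φ = 1 := mul_eq_one_comm.1 hR
  have hM := h.moment_comp hdet
  rw [rotMat_det, inv_one, abs_one, one_smul] at hM
  set R := rotMat φ
  set M' := moment fun x => N (R *ᵥ x)
  have hRM : R * M' = moment N * R := by
    rw [← hM, Matrix.mul_assoc, hR', Matrix.mul_one]
  have hdet' : M'.det = (moment N).det := by
    rw [← hM]; simp [R, rotMat_det]
  have hRS : R * sqrtMoment (fun x => N (R *ᵥ x)) = sqrtMoment N * R := by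
    unfold sqrtMoment
    rw [Matrix.mul_add, Matrix.add_mul, hRM, hdet']
    simp
  have : profile (fun x => N (R *ᵥ x)) = fun θ => profile N (θ + φ) := by
    funext θ
    rw [profile, Matrix.mulVec_mulVec, hRS, ← Matrix.mulVec_mulVec, rotMat_mulVec_circ, profile]
  rw [coeff, this, fourierInt_shift (profile_periodic N), coeff]

theorem parallelogram_of_coeff_eq_zero (h : IsPlaneNorm N c)
    (h0 : ∀ m : ℤ, m ≠ 0 → coeff N m = 0) (x y : Fin 2 → ℝ) :
    N (x + y) * N (x + y) + N (x - y) * N (x - y) = 2 * (N x * N x + N y * N y) := by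
  have hconst := const_of_fourierInt_eq_zero h.profile_continuous (profile_periodic N) h0
  set S := sqrtMoment N
  set r := profile N 0
  have hS : IsUnit S.det := isUnit_iff_ne_zero.2 h.sqrtMoment_det_pos.ne'
  have key : ∀ v : Fin 2 → ℝ, N (S *ᵥ v) * N (S *ᵥ v) = r * r * (v 0 ^ 2 + v 1 ^ 2) := by
    intro v
    let z : ℂ := ⟨v 0, v 1⟩
    have hv : v = ‖z‖ • circ z.arg := by
      ext i
      fin_cases i
      · simp [circ, Complex.norm_mul_cos_arg, z]
      · simp [circ, Complex.norm_mul_sin_arg, z]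
    have hz : ‖z‖ * ‖z‖ = v 0 ^ 2 + v 1 ^ 2 := by
      rw [← sq, Complex.sq_norm, Complex.normSq_apply]
      simp only [z]; ring
    have : N (S *ᵥ v) = ‖z‖ * r := by
      conv_lhs => rw [hv, Matrix.mulVec_smul, h.smul, abs_norm]
      rw [← hconst z.arg, profile]
    rw [this, ← hz]; ring
  have key' : ∀ v : Fin 2 → ℝ, N v * N v = r * r * ((S⁻¹ *ᵥ v) 0 ^ 2 + (S⁻¹ *ᵥ v) 1 ^ 2) := by
    intro v
    rw [← key, Matrix.mulVec_mulVec, Matrix.mul_nonsing_inv _ hS, Matrix.one_mulVec]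
  rw [key', key', key' x, key' y, Matrix.mulVec_add, Matrix.mulVec_sub]
  simp only [Pi.add_apply, Pi.sub_apply]
  ring

end IsPlaneNorm

/-- The Fourier coefficients of a continuous family of uniformly bounded below planar norms
depend continuously on the parameter. -/
theorem continuous_coeff {P : Type*} [TopologicalSpace P] [FirstCountableTopology P]
    [LocallyCompactSpace P] {N : P → (Fin 2 → ℝ) → ℝ} {c : ℝ}
    (hN : Continuous (Function.uncurry N)) (h : ∀ p, IsPlaneNorm (N p) c) (m : ℤ) :
    Continuous fun p => coeff (N p) m := by
  have hmom : Continuous fun p => moment (N p) := by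
    refine continuous_matrix fun i j => ?_
    have e : ∀ p, moment (N p) i j =
        ∫ x in Metric.closedBall (0 : Fin 2 → ℝ) c⁻¹, tent (N p) x * (x i * x j) := fun p =>
      (setIntegral_eq_integral_of_forall_compl_eq_zero fun x hx => by
        rw [IsPlaneNorm.tent_eq_zero (h p).pos (h p).le hx, zero_mul]).symm
    simp_rw [e]
    refine continuous_parametric_integral_of_continuous ?_ (isCompact_closedBall _ _)
    unfold tent
    simp only [Function.uncurry_def] at hN ⊢
    fun_prop
  have hS : Continuous fun p => sqrtMoment (N p) :=
    hmom.add (hmom.matrix_det.sqrt.smul continuous_const)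
  have hprof : Continuous fun q : P × ℝ => profile (N q.1) q.2 :=
    hN.comp (continuous_fst.prodMk
      ((hS.comp continuous_fst).matrix_mulVec (continuous_circ.comp continuous_snd)))
  refine intervalIntegral.continuous_parametric_intervalIntegral_of_continuous' ?_ _ _
  simp only [Function.uncurry_def]
  fun_prop


theorem IsPlaneNorm.of_linearMap {X : Type u} [NormedAddCommGroup X] [NormedSpace ℝ X]
    (g : (Fin 2 → ℝ) →ₗ[ℝ] X) {c : ℝ} (hc : 0 < c) (h : ∀ x, c * ‖x‖ ≤ ‖g x‖) :
    IsPlaneNorm (fun x => ‖g x‖) c where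
  cont := g.continuous_of_finiteDimensional.norm
  pos := hc
  le := h
  smul a x := by rw [map_smul, norm_smul, Real.norm_eq_abs]

/-- The first two columns of the matrix of the quaternion `w + s i + z k`, where `p = w + z i` and
`s` is chosen so that the quaternion has norm one when `p` lies in the unit disc. On the unit
circle, this is a rotation of the coordinate plane by twice the argument of `p`. -/
def frameMat (p : ℂ) : Matrix (Fin 3) (Fin 2) ℝ :=
  let s := √(max 0 (1 - (p.re ^ 2 + p.im ^ 2)))
  !![p.re ^ 2 + s ^ 2 - p.im ^ 2, -(2 * p.re * p.im);
    2 * p.re * p.im, p.re ^ 2 - s ^ 2 - p.im ^ 2;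
    2 * s * p.im, 2 * p.re * s]

theorem continuous_frameMat : Continuous frameMat := by
  refine continuous_matrix fun i j => ?_
  fin_cases i <;> fin_cases j <;> simp [frameMat] <;> fun_prop

theorem frameMat_exp_mulVec (t : ℝ) (x : Fin 2 → ℝ) :
    frameMat (Complex.exp (t * Complex.I)) *ᵥ x = frameMat 1 *ᵥ (rotMat (2 * t) *ᵥ x) := by
  have h := Real.sin_sq_add_cos_sq t
  ext i
  fin_cases i <;>
    simp [frameMat, rotMat, Matrix.mulVec, dotProduct, Fin.sum_univ_two,
      Complex.exp_ofReal_mul_I_re, Complex.exp_ofReal_mul_I_im, Real.cos_two_mul,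
      Real.sin_two_mul]
  · linear_combination (-x 0) * h
  · linear_combination (-x 1) * h

theorem norm_le_two_mul_norm_frameMat_mulVec (p : ℂ) (x : Fin 2 → ℝ) :
    ‖x‖ ≤ 2 * ‖frameMat p *ᵥ x‖ := by
  set y := frameMat p *ᵥ x with hy
  set s := √(max 0 (1 - (p.re ^ 2 + p.im ^ 2))) with hs
  have hs2 : 1 ≤ p.re ^ 2 + p.im ^ 2 + s ^ 2 := by
    rw [hs, Real.sq_sqrt (le_max_left _ _)]
    linarith [le_max_right 0 (1 - (p.re ^ 2 + p.im ^ 2))]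
  have hsum : y 0 ^ 2 + y 1 ^ 2 + y 2 ^ 2 =
      (x 0 ^ 2 + x 1 ^ 2) * (p.re ^ 2 + p.im ^ 2 + s ^ 2) ^ 2 := by
    simp [hy, frameMat, dotProduct, Fin.sum_univ_two, ← hs]
    ring
  have hge : x 0 ^ 2 + x 1 ^ 2 ≤ y 0 ^ 2 + y 1 ^ 2 + y 2 ^ 2 := by
    rw [hsum]
    exact le_mul_of_one_le_right (by positivity) (one_le_pow₀ hs2)
  have hyi : ∀ i, y i ^ 2 ≤ ‖y‖ ^ 2 := fun i =>
    sq_le_sq' (by linarith [neg_abs_le (y i), norm_le_pi_norm y i, Real.norm_eq_abs (y i)])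
      ((le_abs_self _).trans (norm_le_pi_norm y i))
  refine (pi_norm_le_iff_of_nonneg (by positivity)).2 fun i => ?_
  refine abs_le_of_sq_le_sq ?_ (by positivity)
  have h0 := hyi 0
  have h1 := hyi 1
  have h2 := hyi 2
  have h3 : x i ^ 2 ≤ x 0 ^ 2 + x 1 ^ 2 := by
    fin_cases i <;> simp <;> positivity
  nlinarith [sq_nonneg ‖y‖]

section Space

variable {X : Type u} [NormedAddCommGroup X] [NormedSpace ℝ X]

theorem exists_lower_bound_frame {v : Fin 3 → X} (hv : LinearIndependent ℝ v) :
    ∃ c > 0, ∀ p x, c * ‖x‖ ≤ ‖Fintype.linearCombination ℝ v (frameMat p *ᵥ x)‖ := by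
  have hinj : LinearMap.ker (Fintype.linearCombination ℝ v) = ⊥ :=
    LinearMap.ker_eq_bot.2 hv.fintypeLinearCombination_injective
  obtain ⟨K, hK, hT⟩ := (Fintype.linearCombination ℝ v).exists_antilipschitzWith hinj
  have hK' : (0 : ℝ) < K := hK
  refine ⟨(2 * K)⁻¹, by positivity, fun p x => ?_⟩
  have h1 := norm_le_two_mul_norm_frameMat_mulVec p x
  have h2 := hT.le_mul_dist (frameMat p *ᵥ x) 0
  rw [map_zero, dist_zero_right, dist_zero_right] at h2
  rw [inv_mul_le_iff₀ (by positivity)]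
  nlinarith

/-- The invariant `coeffRatio` of two-dimensional subspaces of a three-dimensional space takes
every value between zero and any value that it takes. -/
theorem exists_plane_coeffRatio_eq {v : Fin 3 → X} (hv : LinearIndependent ℝ v) {m : ℤ}
    (hm : m ≠ 0) {y : ℝ} (hy : 0 ≤ y)
    (hy' : y ≤ coeffRatio (fun x => ‖x 0 • v 0 + x 1 • v 1‖) m) :
    ∃ (g : (Fin 2 → ℝ) →ₗ[ℝ] X) (c : ℝ), IsPlaneNorm (fun x => ‖g x‖) c ∧
      coeffRatio (fun x => ‖g x‖) m = y := by
  obtain ⟨c, hc, hle⟩ := exists_lower_bound_frame hv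
  let g : ℂ → (Fin 2 → ℝ) →ₗ[ℝ] X := fun p =>
    Fintype.linearCombination ℝ v ∘ₗ (frameMat p).mulVecLin
  let N : ℂ → (Fin 2 → ℝ) → ℝ := fun p x => ‖g p x‖
  have hN : ∀ p, IsPlaneNorm (N p) c := fun p => .of_linearMap (g p) hc (hle p)
  have hT : Continuous (Fintype.linearCombination ℝ v) :=
    LinearMap.continuous_of_finiteDimensional _
  have hNc : Continuous (Function.uncurry N) := by
    have : Continuous fun q : ℂ × (Fin 2 → ℝ) => frameMat q.1 *ᵥ q.2 :=
      (continuous_frameMat.comp continuous_fst).matrix_mulVec continuous_snd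
    exact (hT.comp this).norm
  have hcoeff := continuous_coeff hNc hN
  have hratio : Continuous fun p => coeffRatio (N p) m :=
    (hcoeff m).norm.div (hcoeff 0).norm fun p => norm_ne_zero_iff.2 (hN p).coeff_zero_ne_zero
  have hone : N 1 = fun x => ‖x 0 • v 0 + x 1 • v 1‖ := by
    funext x
    simp [N, g, frameMat, Fintype.linearCombination_apply, Fin.sum_univ_three,
      dotProduct, Fin.sum_univ_two]
  have hzero : ∃ p, coeff (N p) m = 0 := by
    by_contra! hne
    refine not_forall_circle_eq_exp_mul (hcoeff m) hne (k := 2 * m) (by positivity) fun t => ?_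
    have : N (Complex.exp (t * Complex.I)) = fun x => N 1 (rotMat (2 * t) *ᵥ x) := by
      funext x
      simp only [N, g, LinearMap.comp_apply, Matrix.mulVecLin_apply, frameMat_exp_mulVec]
    rw [this, (hN 1).coeff_comp_rotMat]
    congr 2
    push_cast; ring
  obtain ⟨p₀, hp₀⟩ := hzero
  obtain ⟨p, hp⟩ := mem_range_of_exists_le_of_exists_ge hratio
    ⟨p₀, by simpa [coeffRatio, hp₀] using hy⟩ ⟨1, by rwa [hone]⟩
  exact ⟨g p, c, hN p, hp⟩

/-- In a non-Euclidean space of dimension at least three, some two independent vectors violate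
the parallelogram law. -/
theorem exists_linearIndependent_not_parallelogram [FiniteDimensional ℝ X]
    (hn : 3 ≤ Module.finrank ℝ X)
    (h : IsEmpty (X ≃ₗᵢ[ℝ] EuclideanSpace ℝ (Fin (Module.finrank ℝ X)))) :
    ∃ v : Fin 3 → X, LinearIndependent ℝ v ∧
      ‖v 0 + v 1‖ * ‖v 0 + v 1‖ + ‖v 0 - v 1‖ * ‖v 0 - v 1‖ ≠
        2 * (‖v 0‖ * ‖v 0‖ + ‖v 1‖ * ‖v 1‖) := by
  obtain ⟨a, b, hab⟩ : ∃ a b : X, ‖a + b‖ * ‖a + b‖ + ‖a - b‖ * ‖a - b‖ ≠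
      2 * (‖a‖ * ‖a‖ + ‖b‖ * ‖b‖) := by
    by_contra! hpar
    let : InnerProductSpace ℝ X := InnerProductSpace.ofNorm ℝ hpar
    exact h.false (stdOrthonormalBasis ℝ X).repr
  have hind : LinearIndependent ℝ ![a, b] := by
    by_contra hdep
    have hdep' : ∃ (r s : ℝ) (u : X), a = r • u ∧ b = s • u := by
      by_cases ha : a = 0
      · exact ⟨0, 1, b, by simp [ha], by simp⟩
      · have := mt (LinearIndependent.pair_iff' ha).2 hdep
        push Not at this
        obtain ⟨s, hs⟩ := this
        exact ⟨1, s, a, by simp, hs.symm⟩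
    obtain ⟨r, s, u, rfl, rfl⟩ := hdep'
    apply hab
    rw [← add_smul, ← sub_smul]
    simp only [norm_smul, Real.norm_eq_abs]
    have e : ∀ t : ℝ, |t| * ‖u‖ * (|t| * ‖u‖) = t * t * (‖u‖ * ‖u‖) := fun t => by
      rw [← abs_mul_abs_self t]; ring
    simp only [e]
    ring
  obtain ⟨w, hw⟩ := exists_linearIndependent_cons_of_lt_finrank hind (by omega)
  refine ⟨![a, b, w], ?_, hab⟩
  have hperm : (Fin.cons w ![a, b] : Fin 3 → X) ∘ ![1, 2, 0] = ![a, b, w] := by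
    ext i
    fin_cases i <;> rfl
  rw [← hperm]
  exact hw.comp ![1, 2, 0] (by decide)

/-- The class of the plane spanned by an injective linear map. -/
def planeNorm (g : (Fin 2 → ℝ) →ₗ[ℝ] X) (hg : Function.Injective g) : MNorm 2 where
  toFun x := ‖g x‖
  add_le' x y := by rw [map_add]; exact norm_add_le _ _
  smul_eq' a x := by rw [map_smul, norm_smul, Real.norm_eq_abs]
  eq_zero' x hx := by rwa [norm_eq_zero, map_eq_zero_iff g hg] at hx

theorem minkClass_planeNorm_mem (g : (Fin 2 → ℝ) →ₗ[ℝ] X) (hg : Function.Injective g) :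
    minkClass (planeNorm g hg) ∈ HSet X := by
  obtain ⟨e, he⟩ : (mnormSetoid 2).r (Quotient.out (Quotient.mk (mnormSetoid 2) (planeNorm g hg)))
    (planeNorm g hg) := Quotient.exact (Quotient.out_eq _)
  exact ⟨g ∘ₗ e.toLinearMap, hg.comp e.injective, he⟩

theorem coeffRatio_eq_of_minkClass_eq {N₁ N₂ : MNorm 2} {c : ℝ} (h : IsPlaneNorm N₂.toFun c)
    (heq : minkClass N₁ = minkClass N₂) (m : ℤ) :
    coeffRatio N₁.toFun m = coeffRatio N₂.toFun m := by
  obtain ⟨e, he⟩ : (mnormSetoid 2).r N₁ N₂ :=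
    Quotient.exact (eq_of_heq (Sigma.mk.inj heq).2)
  have hdet : (LinearMap.toMatrix' e.toLinearMap).det ≠ 0 := by
    rw [LinearMap.det_toMatrix']
    exact e.isUnit_det'.ne_zero
  rw [← h.coeffRatio_comp hdet m]
  congr 1
  funext x
  rw [LinearMap.toMatrix'_mulVec]
  exact (he x).symm

theorem MNorm.ext_toFun {n : ℕ} {N₁ N₂ : MNorm n} (h : ∀ x, N₁.toFun x = N₂.toFun x) :
    N₁ = N₂ := by
  cases N₁; cases N₂
  congr
  exact funext h

theorem card_HSet_le_continuum [FiniteDimensional ℝ X] :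
    Cardinal.mk (HSet X) ≤ Cardinal.continuum := by
  choose f _ hf using fun c : HSet X => c.2
  let φ := (Module.finBasis ℝ X).equivFun
  let F : HSet X → Σ n : ℕ, Matrix (Fin (Module.finrank ℝ X)) (Fin n) ℝ := fun c =>
    ⟨c.1.1, LinearMap.toMatrix' (φ.toLinearMap ∘ₗ f c)⟩
  have hF : Function.Injective F := by
    rintro ⟨⟨n, P⟩, hP⟩ ⟨⟨k, Q⟩, hQ⟩ h
    obtain rfl : n = k := (Sigma.mk.inj h).1
    have h2 := LinearMap.toMatrix'.injective (eq_of_heq (Sigma.mk.inj h).2)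
    have hPQ : Quotient.out P = Quotient.out Q := MNorm.ext_toFun fun x => by
      have h3 : f ⟨⟨n, P⟩, hP⟩ x = f ⟨⟨n, Q⟩, hQ⟩ x :=
        φ.injective (LinearMap.congr_fun h2 x)
      exact (hf ⟨⟨n, P⟩, hP⟩ x).symm.trans ((congrArg norm h3).trans (hf ⟨⟨n, Q⟩, hQ⟩ x))
    obtain rfl : P = Q :=
      (Quotient.out_eq P).symm.trans ((congrArg _ hPQ).trans (Quotient.out_eq Q))
    rfl
  have hpow : ∀ n : ℕ, Cardinal.continuum ^ n ≤ Cardinal.continuum := fun n =>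
    Cardinal.power_nat_le Cardinal.aleph0_le_continuum
  refine (Cardinal.mk_le_of_injective hF).trans ?_
  rw [Cardinal.mk_sigma]
  refine (Cardinal.sum_le_sum _ (fun _ => Cardinal.continuum) fun n => ?_).trans (by simp)
  have : Cardinal.mk (Matrix (Fin (Module.finrank ℝ X)) (Fin n) ℝ) =
      (Cardinal.continuum ^ n) ^ Module.finrank ℝ X := by
    change Cardinal.mk (Fin _ → Fin n → ℝ) = _
    simp [Cardinal.mk_real]
  rw [this]
  exact (Cardinal.power_le_power_right (hpow n)).trans (hpow _)

theorem continuum_le_card_HSet [FiniteDimensional ℝ X] (hn : 3 ≤ Module.finrank ℝ X)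
    (h : IsEmpty (X ≃ₗᵢ[ℝ] EuclideanSpace ℝ (Fin (Module.finrank ℝ X)))) :
    Cardinal.continuum ≤ Cardinal.mk (HSet X) := by
  obtain ⟨v, hv, hpar⟩ := exists_linearIndependent_not_parallelogram hn h
  let N : (Fin 2 → ℝ) → ℝ := fun x => ‖x 0 • v 0 + x 1 • v 1‖
  obtain ⟨c, hN⟩ : ∃ c, IsPlaneNorm N c := by
    obtain ⟨c, hc, hle⟩ := exists_lower_bound_frame hv
    have hN' := IsPlaneNorm.of_linearMap
      (Fintype.linearCombination ℝ v ∘ₗ (frameMat 1).mulVecLin) hc (hle 1)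
    refine ⟨c, ?_⟩
    convert hN' using 1
    funext x
    simp [N, frameMat, Fintype.linearCombination_apply, Fin.sum_univ_three,
      dotProduct, Fin.sum_univ_two]
  obtain ⟨m, hm, hcoeff⟩ : ∃ m : ℤ, m ≠ 0 ∧ coeff N m ≠ 0 := by
    by_contra! h0
    have := hN.parallelogram_of_coeff_eq_zero h0 ![1, 0] ![0, 1]
    apply hpar
    simpa [N, ← sub_eq_add_neg] using this
  have hpos : 0 < coeffRatio N m :=
    div_pos (norm_pos_iff.2 hcoeff) (norm_pos_iff.2 hN.coeff_zero_ne_zero)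
  have hex : ∀ y : Set.Icc 0 (coeffRatio N m), ∃ (g : (Fin 2 → ℝ) →ₗ[ℝ] X) (c : ℝ),
      IsPlaneNorm (fun x => ‖g x‖) c ∧ coeffRatio (fun x => ‖g x‖) m = y :=
    fun y => exists_plane_coeffRatio_eq hv hm y.2.1 y.2.2
  choose g c' hg hgy using hex
  have hinj : ∀ y, Function.Injective (g y) := fun y => by
    refine (injective_iff_map_eq_zero _).2 fun x hx => ?_
    by_contra hx0
    exact ((hg y).apply_pos hx0).ne' (by simp [hx])
  let G : Set.Icc 0 (coeffRatio N m) → HSet X := fun y =>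
    ⟨minkClass (planeNorm (g y) (hinj y)), minkClass_planeNorm_mem _ _⟩
  have hG : Function.Injective G := fun y z hyz => by
    have := coeffRatio_eq_of_minkClass_eq (N₁ := planeNorm (g y) (hinj y)) (hg z)
      (congrArg Subtype.val hyz) m
    exact Subtype.ext ((hgy y).symm.trans (this.trans (hgy z)))
  rw [← Cardinal.mk_Icc_real hpos]
  exact Cardinal.mk_le_of_injective hG

end Space

/-- If `X` is a finite-dimensional real Banach space with `dim X = n ≥ 3`
which is not isometric to the Euclidean space `ℓ₂⁽ⁿ⁾`, then the set `H(X)` of isometry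
classes of subspaces of `X` has cardinality exactly the continuum. -/
theorem card_HSet_eq_continuum
    (X : Type u) [NormedAddCommGroup X] [NormedSpace ℝ X] [FiniteDimensional ℝ X]
    (hn : 3 ≤ Module.finrank ℝ X)
    (hnoteuc : IsEmpty (X ≃ₗᵢ[ℝ] EuclideanSpace ℝ (Fin (Module.finrank ℝ X)))) :
    Cardinal.mk (HSet X) = Cardinal.continuum := by
  exact le_antisymm card_HSet_le_continuum (continuum_le_card_HSet hn hnoteuc)
end
end

section
/- (Synthesis theorem) Let 𝔑 be a nonempty subset of the Minkowski space 𝔐. There exists a Banach space X_𝔑 whose Minkowski base 𝔐(X_𝔑^f) (i.e., the closure of H(X_𝔑) in 𝔐) equals 𝔑 if and only if 𝔑 satisfies: (H) if A ∈ 𝔑 and B is the isometry class of a subspace of A, then B ∈ 𝔑; (A₀) if A, B ∈ 𝔑 then there exists C ∈ 𝔑 such that both A and B are isometry classes of subspaces of C; and (C) 𝔑 is closed in 𝔐. -/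
noncomputable section

universe u

/-- `B` is (the isometry class of) a subspace of (any representative of) `A`. -/
def IsSubClass (B A : MinkSpace) : Prop :=
  ∃ f : (Fin B.1 → ℝ) →ₗ[ℝ] (Fin A.1 → ℝ), Function.Injective f ∧
    ∀ v, (Quotient.out A.2).toFun (f v) = (Quotient.out B.2).toFun v

namespace MNorm

variable {n : ℕ}

lemma map_zero (N : MNorm n) : N.toFun 0 = 0 := by
  simpa using N.smul_eq' 0 0

lemma map_neg (N : MNorm n) (x : Fin n → ℝ) : N.toFun (-x) = N.toFun x := by
  simpa using N.smul_eq' (-1) x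

lemma nonneg (N : MNorm n) (x : Fin n → ℝ) : 0 ≤ N.toFun x := by
  have h := N.add_le' x (-x)
  rw [add_neg_cancel, N.map_zero, N.map_neg] at h
  linarith

/-- The normed space `(ℝ^n, N)`. -/
def Space (_ : MNorm n) : Type := Fin n → ℝ

instance (N : MNorm n) : AddCommGroup N.Space := inferInstanceAs (AddCommGroup (Fin n → ℝ))

instance (N : MNorm n) : Module ℝ N.Space := inferInstanceAs (Module ℝ (Fin n → ℝ))

instance (N : MNorm n) : Norm N.Space := ⟨N.toFun⟩

lemma spaceCore (N : MNorm n) : NormedSpace.Core ℝ N.Space where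
  norm_nonneg := N.nonneg
  norm_smul := N.smul_eq'
  norm_triangle := N.add_le'
  norm_eq_zero_iff x := ⟨N.eq_zero' x, fun h => h ▸ N.map_zero⟩

instance (N : MNorm n) : NormedAddCommGroup N.Space := .ofCore N.spaceCore

instance (N : MNorm n) : NormedSpace ℝ N.Space := .ofCore N.spaceCore

instance (N : MNorm n) : FiniteDimensional ℝ N.Space :=
  inferInstanceAs (FiniteDimensional ℝ (Fin n → ℝ))

instance (N : MNorm n) : CompleteSpace N.Space := FiniteDimensional.complete ℝ _

/-- The identity map from `ℝ^n` to `(ℝ^n, N)`. -/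
def toSpace (N : MNorm n) : (Fin n → ℝ) ≃ₗ[ℝ] N.Space := LinearEquiv.refl ℝ (Fin n → ℝ)

lemma norm_toSpace (N : MNorm n) (x : Fin n → ℝ) : ‖N.toSpace x‖ = N.toFun x := rfl

/-- The norm on `ℝ^n` induced by an injective linear map to a seminormed space
on whose range the seminorm is definite. -/
def comap {X : Type*} [SeminormedAddCommGroup X] [NormedSpace ℝ X] (g : (Fin n → ℝ) →ₗ[ℝ] X)
    (hg : ∀ x, ‖g x‖ = 0 → x = 0) : MNorm n where
  toFun x := ‖g x‖
  add_le' x y := by simpa using norm_add_le (g x) (g y)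
  smul_eq' a x := by simp [norm_smul]
  eq_zero' := hg

/-- Two norms on `ℝ^n` are `r`-close if, after a linear change of variables, they differ by a
factor between `1` and `r`. -/
def Near (r : ℝ) (N₁ N₂ : MNorm n) : Prop :=
  ∃ u : (Fin n → ℝ) ≃ₗ[ℝ] (Fin n → ℝ), ∀ x, N₁.toFun x ≤ N₂.toFun (u x) ∧
    N₂.toFun (u x) ≤ r * N₁.toFun x

lemma Near.trans {r s : ℝ} (hs : 0 ≤ s) {N₁ N₂ N₃ : MNorm n} (h : Near r N₁ N₂)
    (h' : Near s N₂ N₃) : Near (r * s) N₁ N₃ := by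
  obtain ⟨u, hu⟩ := h
  obtain ⟨v, hv⟩ := h'
  refine ⟨u.trans v, fun x => ⟨(hu x).1.trans (hv _).1, (hv _).2.trans ?_⟩⟩
  calc s * N₂.toFun (u x) ≤ s * (r * N₁.toFun x) := mul_le_mul_of_nonneg_left (hu x).2 hs
    _ = r * s * N₁.toFun x := by ring

lemma exists_opC_bound (N₁ N₂ : MNorm n) (u : (Fin n → ℝ) →ₗ[ℝ] (Fin n → ℝ)) :
    {C : ℝ | 0 ≤ C ∧ ∀ x, N₂.toFun (u x) ≤ C * N₁.toFun x}.Nonempty := by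
  let f : N₁.Space →L[ℝ] N₂.Space := LinearMap.toContinuousLinearMap
    (N₂.toSpace.toLinearMap ∘ₗ u ∘ₗ N₁.toSpace.symm.toLinearMap)
  exact ⟨‖f‖, norm_nonneg _, fun x => f.le_opNorm (N₁.toSpace x)⟩

lemma opC_nonneg (N₁ N₂ : MNorm n) (u : (Fin n → ℝ) →ₗ[ℝ] (Fin n → ℝ)) :
    0 ≤ opC n N₁ N₂ u := Real.sInf_nonneg fun _ h => h.1

lemma le_opC (N₁ N₂ : MNorm n) (u : (Fin n → ℝ) →ₗ[ℝ] (Fin n → ℝ)) (x : Fin n → ℝ) :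
    N₂.toFun (u x) ≤ opC n N₁ N₂ u * N₁.toFun x := by
  rcases (N₁.nonneg x).eq_or_lt with h | h
  · rw [N₁.eq_zero' x h.symm]; simp [map_zero]
  · rw [← div_le_iff₀ h]
    refine le_csInf (exists_opC_bound N₁ N₂ u) fun C hC => ?_
    rw [div_le_iff₀ h]
    exact hC.2 x

lemma opC_le {N₁ N₂ : MNorm n} {u : (Fin n → ℝ) →ₗ[ℝ] (Fin n → ℝ)} {C : ℝ} (hC : 0 ≤ C)
    (h : ∀ x, N₂.toFun (u x) ≤ C * N₁.toFun x) : opC n N₁ N₂ u ≤ C :=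
  csInf_le ⟨0, fun _ h => h.1⟩ ⟨hC, h⟩

lemma mDist_nonneg (N₁ N₂ : MNorm n) : 0 ≤ mDist n N₁ N₂ := by
  refine Real.sInf_nonneg ?_
  rintro _ ⟨u, rfl⟩
  exact mul_nonneg (opC_nonneg _ _ _) (opC_nonneg _ _ _)

lemma near_of_mDist_lt {N₁ N₂ : MNorm n} {r : ℝ} (h : mDist n N₁ N₂ < r) : Near r N₁ N₂ := by
  obtain ⟨_, ⟨u, rfl⟩, hu⟩ := exists_lt_of_csInf_lt (by exact ⟨_, LinearEquiv.refl ℝ _, rfl⟩) h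
  set a := opC n N₂ N₁ u.symm.toLinearMap
  have ha : ∀ x, N₁.toFun x ≤ a * N₂.toFun (u x) := fun x => by
    simpa using le_opC N₂ N₁ u.symm.toLinearMap (u x)
  have hb : ∀ x, N₂.toFun (u x) ≤ _ := fun x => le_opC N₁ N₂ u.toLinearMap x
  rcases (opC_nonneg N₂ N₁ u.symm.toLinearMap).eq_or_lt with h0 | h0
  · refine ⟨u, fun x => ?_⟩
    have h1 : N₁.toFun x ≤ 0 := by simpa [a, ← h0] using ha x
    rw [N₁.eq_zero' x (le_antisymm h1 (N₁.nonneg x))]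
    simp [map_zero]
  · refine ⟨u.trans (LinearEquiv.smulOfNeZero ℝ _ a h0.ne'), fun x => ?_⟩
    have : N₂.toFun ((u.trans (LinearEquiv.smulOfNeZero ℝ _ a h0.ne')) x)
        = a * N₂.toFun (u x) := by
      simpa [abs_of_pos (show 0 < a from h0)] using N₂.smul_eq' a (u x)
    rw [this]
    refine ⟨ha x, ?_⟩
    calc a * N₂.toFun (u x) ≤ a * (opC n N₁ N₂ u.toLinearMap * N₁.toFun x) :=
          mul_le_mul_of_nonneg_left (hb x) h0.le
      _ = opC n N₁ N₂ u.toLinearMap * a * N₁.toFun x := by ring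
      _ ≤ r * N₁.toFun x := mul_le_mul_of_nonneg_right hu.le (N₁.nonneg x)

lemma Near.mDist_le {N₁ N₂ : MNorm n} {r : ℝ} (hr : 0 ≤ r) (h : Near r N₁ N₂) :
    mDist n N₁ N₂ ≤ r := by
  obtain ⟨u, hu⟩ := h
  have h1 : opC n N₁ N₂ u.toLinearMap ≤ r := opC_le hr fun x => (hu x).2
  have h2 : opC n N₂ N₁ u.symm.toLinearMap ≤ 1 := opC_le zero_le_one fun x => by
    simpa using (hu (u.symm x)).1
  calc mDist n N₁ N₂ ≤ opC n N₁ N₂ u.toLinearMap * opC n N₂ N₁ u.symm.toLinearMap := by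
        refine csInf_le ⟨0, ?_⟩ ⟨u, rfl⟩
        rintro _ ⟨v, rfl⟩
        exact mul_nonneg (opC_nonneg _ _ _) (opC_nonneg _ _ _)
    _ ≤ r * 1 := mul_le_mul h1 h2 (opC_nonneg _ _ _) hr
    _ = r := mul_one r

lemma exists_equiv_out (N : MNorm n) : ∃ e : (Fin n → ℝ) ≃ₗ[ℝ] (Fin n → ℝ),
    ∀ x, (Quotient.out (minkClass N).2).toFun (e x) = N.toFun x :=
  (mnormSetoid n).symm (Quotient.mk_out (s := mnormSetoid n) N)

end MNorm

open MNorm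

lemma near_of_minkDist_lt {n : ℕ} {P Q : Mink n} {ε : ℝ} (h : minkDist n P Q < ε) :
    Near (Real.exp ε) P.out Q.out := by
  refine near_of_mDist_lt ?_
  rcases (mDist_nonneg P.out Q.out).eq_or_lt with h0 | h0
  · rw [← h0]; exact Real.exp_pos ε
  · exact (Real.log_lt_iff_lt_exp h0).1 h

lemma minkDist_le_of_near {n : ℕ} {P Q : Mink n} {ε : ℝ} (hε : 0 ≤ ε)
    (h : Near (Real.exp ε) P.out Q.out) : minkDist n P Q ≤ ε := by
  have h1 := h.mDist_le (Real.exp_pos ε).le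
  rcases (mDist_nonneg P.out Q.out).eq_or_lt with h0 | h0
  · rw [minkDist, ← h0, Real.log_zero]; exact hε
  · exact (Real.log_le_iff_le_exp h0).2 h1

lemma minkDist_self_le {n : ℕ} (P : Mink n) : minkDist n P P ≤ 0 :=
  minkDist_le_of_near le_rfl ⟨LinearEquiv.refl ℝ _, fun x => by simp⟩

open Topology in
lemma mink_nhds_hasBasis {n : ℕ} (P : Mink n) :
    (𝓝 P).HasBasis (fun ε : ℝ => 0 < ε) fun ε => {Q | minkDist n P Q < ε} := by
  have hle : 𝓝 P = ⨅ ε ∈ Set.Ioi (0 : ℝ), Filter.principal {Q | minkDist n P Q < ε} := by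
    refine le_antisymm (le_iInf₂ fun ε hε => ?_) ?_
    · exact Filter.le_principal_iff.2 <| IsOpen.mem_nhds
        (TopologicalSpace.isOpen_generateFrom_of_mem ⟨P, ε, hε, rfl⟩)
        (lt_of_le_of_lt (minkDist_self_le P) hε)
    · rw [TopologicalSpace.nhds_generateFrom]
      refine le_iInf₂ ?_
      rintro _ ⟨hPs, R, δ, hδ, rfl⟩
      obtain ⟨a, ha, haδ⟩ := exists_between (max_lt hPs hδ)
      refine iInf₂_le_of_le ((δ - a) / 2) (half_pos (sub_pos.2 haδ)) ?_
      refine Filter.principal_mono.2 fun Q hQ => ?_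
      have h1 := near_of_minkDist_lt (lt_of_le_of_lt (le_max_left _ _) ha)
      have h2 := h1.trans (Real.exp_pos _).le (near_of_minkDist_lt hQ)
      rw [← Real.exp_add] at h2
      have h3 := lt_of_le_of_lt (le_max_right _ _) ha
      have h4 := minkDist_le_of_near (by linarith) h2
      show minkDist n R Q < δ
      linarith
  rw [hle]
  refine Filter.hasBasis_biInf_principal ?_ ⟨1, Set.mem_Ioi.2 zero_lt_one⟩
  intro a ha b hb
  refine ⟨min a b, Set.mem_Ioi.2 (lt_min ha hb), fun Q hQ => ?_, fun Q hQ => ?_⟩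
  · exact lt_of_lt_of_le (show minkDist n P Q < min a b from hQ) (min_le_left _ _)
  · exact lt_of_lt_of_le (show minkDist n P Q < min a b from hQ) (min_le_right _ _)

lemma mem_closure_minkSpace_iff {S : Set MinkSpace} {n : ℕ} {P : Mink n} :
    (⟨n, P⟩ : MinkSpace) ∈ closure S ↔
      ∀ r : ℝ, 1 < r → ∃ Q : Mink n, (⟨n, Q⟩ : MinkSpace) ∈ S ∧ Near r P.out Q.out := by
  have hb := (mink_nhds_hasBasis P).map (Sigma.mk n)
  rw [← Sigma.nhds_mk] at hb
  refine (mem_closure_iff_nhds_basis hb).trans ⟨fun h r hr => ?_, fun h ε hε => ?_⟩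
  · obtain ⟨_, hy, Q, hQ, rfl⟩ := h (Real.log r) (Real.log_pos hr)
    refine ⟨Q, hy, ?_⟩
    simpa [Real.exp_log (zero_lt_one.trans hr)] using near_of_minkDist_lt hQ
  · obtain ⟨Q, hQ, hPQ⟩ := h (Real.exp (ε / 2)) (Real.one_lt_exp_iff.2 (by linarith))
    exact ⟨_, hQ, Q, lt_of_le_of_lt (minkDist_le_of_near (by linarith) hPQ) (by linarith), rfl⟩

section HSet

variable {X : Type*} [SeminormedAddCommGroup X] [NormedSpace ℝ X]

lemma MNorm.injective_of_norm_eq {n : ℕ} (N : MNorm n) {f : (Fin n → ℝ) →ₗ[ℝ] X}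
    (hf : ∀ v, ‖f v‖ = N.toFun v) : Function.Injective f := by
  refine (injective_iff_map_eq_zero f).2 fun v hv => N.eq_zero' v ?_
  rw [← hf, hv, norm_zero]

lemma mem_HSet_iff {n : ℕ} {P : Mink n} : (⟨n, P⟩ : MinkSpace) ∈ HSet X ↔
    ∃ f : (Fin n → ℝ) →ₗ[ℝ] X, ∀ v, ‖f v‖ = P.out.toFun v :=
  ⟨fun ⟨f, _, hf⟩ => ⟨f, hf⟩, fun ⟨f, hf⟩ => ⟨f, P.out.injective_of_norm_eq hf, hf⟩⟩

lemma isSubClass_iff_mem_HSet {A B : MinkSpace} :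
    IsSubClass B A ↔ B ∈ HSet (Quotient.out A.2).Space := Iff.rfl

lemma IsSubClass.mem_HSet {A B : MinkSpace} (h : IsSubClass B A) (hA : A ∈ HSet X) :
    B ∈ HSet X := by
  obtain ⟨f, hf, hfn⟩ := h
  obtain ⟨g, hg, hgn⟩ := hA
  exact ⟨g ∘ₗ f, hg.comp hf, fun v => (hgn _).trans (hfn v)⟩

lemma MNorm.exists_near_mem_HSet {n : ℕ} (N : MNorm n) (g : (Fin n → ℝ) →ₗ[ℝ] X) {r : ℝ}
    (h : ∀ x, N.toFun x ≤ ‖g x‖ ∧ ‖g x‖ ≤ r * N.toFun x) :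
    ∃ Q : Mink n, (⟨n, Q⟩ : MinkSpace) ∈ HSet X ∧ Near r N Q.out := by
  let N' : MNorm n := comap g fun x hx =>
    N.eq_zero' x (le_antisymm ((h x).1.trans hx.le) (N.nonneg x))
  obtain ⟨e, he⟩ := N'.exists_equiv_out
  refine ⟨(minkClass N').2, mem_HSet_iff.2 ⟨g ∘ₗ e.symm.toLinearMap, fun v => ?_⟩, e, fun x => ?_⟩
  · have := he (e.symm v)
    rw [e.apply_symm_apply] at this
    exact this.symm
  · exact ⟨(h x).1.trans (he x).ge, (he x).le.trans (h x).2⟩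

lemma mem_closure_HSet_iff {n : ℕ} {P : Mink n} : (⟨n, P⟩ : MinkSpace) ∈ closure (HSet X) ↔
    ∀ r : ℝ, 1 < r → ∃ g : (Fin n → ℝ) →ₗ[ℝ] X,
      ∀ x, P.out.toFun x ≤ ‖g x‖ ∧ ‖g x‖ ≤ r * P.out.toFun x := by
  rw [mem_closure_minkSpace_iff]
  refine forall₂_congr fun r _ => ⟨?_, fun ⟨g, hg⟩ => P.out.exists_near_mem_HSet g hg⟩
  rintro ⟨Q, hQ, u, hu⟩
  obtain ⟨f, hf⟩ := mem_HSet_iff.1 hQ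
  exact ⟨f ∘ₗ u.toLinearMap, fun x => by simpa [hf] using hu x⟩

lemma IsSubClass.mem_closure_HSet {A B : MinkSpace} (h : IsSubClass B A)
    (hA : A ∈ closure (HSet X)) : B ∈ closure (HSet X) := by
  obtain ⟨n, P⟩ := A
  obtain ⟨m, Q⟩ := B
  obtain ⟨f, -, hf⟩ := h
  refine mem_closure_HSet_iff.2 fun r hr => ?_
  obtain ⟨g, hg⟩ := mem_closure_HSet_iff.1 hA r hr
  exact ⟨g ∘ₗ f, fun x => by simpa only [← hf, LinearMap.comp_apply] using hg (f x)⟩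

/-- Two finite-dimensional subspaces of `X` are contained in a third one. -/
lemma exists_isSubClass_of_mem_HSet {Y : Type*} [NormedAddCommGroup Y] [NormedSpace ℝ Y]
    {A B : MinkSpace} (hA : A ∈ HSet Y) (hB : B ∈ HSet Y) :
    ∃ C ∈ HSet Y, IsSubClass A C ∧ IsSubClass B C := by
  obtain ⟨f, hf, hfn⟩ := hA
  obtain ⟨g, hg, hgn⟩ := hB
  let W : Submodule ℝ Y := LinearMap.range f ⊔ LinearMap.range g
  let e : W ≃ₗ[ℝ] (Fin (Module.finrank ℝ W) → ℝ) := (Module.finBasis ℝ W).equivFun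
  let j := W.subtype ∘ₗ e.symm.toLinearMap
  let N : MNorm _ := comap j fun x hx => by simpa [j] using hx
  obtain ⟨u, hu⟩ := N.exists_equiv_out
  have key : ∀ D : MinkSpace, ∀ h : (Fin D.1 → ℝ) →ₗ[ℝ] Y, LinearMap.range h ≤ W →
      (∀ v, ‖h v‖ = (Quotient.out D.2).toFun v) → IsSubClass D (minkClass N) := by
    intro D h hW hn
    refine isSubClass_iff_mem_HSet.2 (mem_HSet_iff.2
      ⟨(Quotient.out (minkClass N).2).toSpace.toLinearMap ∘ₗ u.toLinearMap ∘ₗ e.toLinearMap ∘ₗ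
        h.codRestrict W fun v => hW ⟨v, rfl⟩, fun v => ?_⟩)
    refine (hu _).trans ?_
    rw [← hn]
    simp [N, comap, j]
  refine ⟨minkClass N, mem_HSet_iff.2 ⟨j ∘ₗ u.symm.toLinearMap, fun v => ?_⟩,
    key A f le_sup_left hfn, key B g le_sup_right hgn⟩
  have := hu (u.symm v)
  rw [u.apply_symm_apply] at this
  exact this.symm

end HSet

section Ultraproduct

open Filter Topology
open scoped ENNReal

/-- Linear maps that are asymptotically isometric pointwise on a finite-dimensional space are
asymptotically isometric uniformly. -/
lemma eventually_almost_isometry {ι E : Type*} {X : ι → Type*} [NormedAddCommGroup E]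
    [NormedSpace ℝ E] [FiniteDimensional ℝ E] [∀ i, SeminormedAddCommGroup (X i)]
    [∀ i, NormedSpace ℝ (X i)] {l : Filter ι} (g : ∀ i, E →ₗ[ℝ] X i) {M : ℝ}
    (hM : ∀ i x, ‖g i x‖ ≤ M * ‖x‖) (hg : ∀ x, Tendsto (fun i => ‖g i x‖) l (𝓝 ‖x‖))
    {ε : ℝ} (hε : 0 < ε) : ∀ᶠ i in l, ∀ x, |‖g i x‖ - ‖x‖| ≤ ε * ‖x‖ := by
  set δ : ℝ := ε / (2 * (|M| + 1)) with hδ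
  have hM0 : 0 < |M| + 1 := by positivity
  have hδ0 : 0 < δ := by positivity
  obtain ⟨t, hts, htfin, ht⟩ := (isCompact_sphere (0 : E) 1).finite_cover_balls hδ0
  have hev : ∀ᶠ i in l, ∀ y ∈ t, |‖g i y‖ - ‖y‖| < ε / 2 := by
    refine (htfin.eventually_all).2 fun y _ => ?_
    have := (Metric.tendsto_nhds.1 (hg y)) (ε / 2) (by positivity)
    simpa [Real.dist_eq] using this
  filter_upwards [hev] with i hi x
  have hunit : ∀ z : E, ‖z‖ = 1 → |‖g i z‖ - ‖z‖| ≤ ε := by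
    intro z hz
    obtain ⟨y, hy, hzy⟩ := Set.mem_iUnion₂.1 (ht (mem_sphere_zero_iff_norm.2 hz))
    rw [Metric.mem_ball, dist_eq_norm] at hzy
    have hy1 : ‖y‖ = 1 := mem_sphere_zero_iff_norm.1 (hts hy)
    have h1 : |‖g i z‖ - ‖g i y‖| ≤ ε / 2 := by
      calc |‖g i z‖ - ‖g i y‖| ≤ ‖g i z - g i y‖ := abs_norm_sub_norm_le _ _
        _ = ‖g i (z - y)‖ := by rw [map_sub]
        _ ≤ M * ‖z - y‖ := hM i _
        _ ≤ (|M| + 1) * δ := by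
          have := le_abs_self M
          gcongr
          linarith
        _ = ε / 2 := by rw [hδ]; field_simp
    have h2 := hi y hy
    rw [abs_le] at *
    rw [abs_lt] at h2
    constructor <;> linarith
  rcases eq_or_ne x 0 with rfl | hx
  · simp
  · have hx0 : 0 < ‖x‖ := norm_pos_iff.2 hx
    have h := hunit (‖x‖⁻¹ • x) (norm_smul_inv_norm (𝕜 := ℝ) hx)
    rw [map_smul, norm_smul, norm_smul, ← mul_sub, abs_mul, norm_inv, norm_norm,
      abs_of_pos (inv_pos.2 hx0), inv_mul_le_iff₀ hx0] at h
    linarith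

variable {ι : Type*} (U : Ultrafilter ι) (X : ι → Type*) [∀ i, NormedAddCommGroup (X i)]
  [∀ i, NormedSpace ℝ (X i)]

/-- The bounded families whose norms tend to zero along `U`. -/
def nullFamilies : Submodule ℝ (lp X ∞) where
  carrier := {f | Tendsto (fun i => ‖f i‖) U (𝓝 0)}
  zero_mem' := by simp
  add_mem' {f g} hf hg := by
    refine squeeze_zero (fun i => norm_nonneg _) (fun i => norm_add_le (f i) (g i)) ?_
    simpa using Tendsto.add hf hg
  smul_mem' c f hf := by
    have := Tendsto.const_mul ‖c‖ hf
    simpa [norm_smul] using this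

variable {U X}

lemma mem_nullFamilies {f : lp X ∞} :
    f ∈ nullFamilies U X ↔ Tendsto (fun i => ‖f i‖) U (𝓝 0) := Iff.rfl

instance isClosed_nullFamilies : IsClosed (nullFamilies U X : Set (lp X ∞)) := by
  refine isClosed_of_closure_subset fun f hf => mem_nullFamilies.2 ?_
  refine Metric.tendsto_nhds.2 fun ε hε => ?_
  obtain ⟨g, hg, hfg⟩ := Metric.mem_closure_iff.1 hf (ε / 2) (half_pos hε)
  filter_upwards [(Metric.tendsto_nhds.1 (mem_nullFamilies.1 hg)) (ε / 2) (half_pos hε)] with i hi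
  rw [dist_eq_norm] at hfg
  have h1 := lp.norm_apply_le_norm ENNReal.top_ne_zero (f - g) i
  have h2 : ‖f i‖ ≤ ‖g i‖ + ‖(f - g) i‖ := by
    simpa using norm_add_le (g i) ((f - g) i)
  simp only [dist_zero_right, norm_norm] at hi ⊢
  linarith

variable (U X) in
/-- The Banach space ultraproduct of a family of normed spaces. -/
abbrev BanachUltraproduct : Type _ := lp X ∞ ⧸ nullFamilies U X

lemma norm_mk_eq_of_tendsto {f : lp X ∞} {L : ℝ} (h : Tendsto (fun i => ‖f i‖) U (𝓝 L)) :
    ‖(Submodule.Quotient.mk f : BanachUltraproduct U X)‖ = L := by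
  classical
  refine le_antisymm (le_of_forall_pos_le_add fun ε hε => ?_)
    (le_of_forall_pos_le_add fun ε hε => ?_)
  · have hL : 0 ≤ L := ge_of_tendsto' h fun i => norm_nonneg _
    have hlt : ∀ᶠ i in U, ‖f i‖ < L + ε := h.eventually (gt_mem_nhds (by linarith))
    have hb : ∀ i, ‖if ‖f i‖ < L + ε then f i else 0‖ ≤ L + ε := by
      intro i
      split_ifs with hi
      · exact hi.le
      · rw [norm_zero]; linarith
    let f' : lp X ∞ := ⟨fun i => if ‖f i‖ < L + ε then f i else 0,
      memℓp_infty ⟨L + ε, by rintro _ ⟨i, rfl⟩; exact hb i⟩⟩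
    have hmk : (Submodule.Quotient.mk f : BanachUltraproduct U X) = Submodule.Quotient.mk f' := by
      refine (Submodule.Quotient.eq _).2 (mem_nullFamilies.2 ?_)
      refine tendsto_const_nhds.congr' ?_
      filter_upwards [hlt] with i hi
      have : f' i = f i := if_pos hi
      rw [lp.coeFn_sub, Pi.sub_apply, this, sub_self, norm_zero]
    rw [hmk]
    exact (Submodule.Quotient.norm_mk_le _ f').trans
      (lp.norm_le_of_forall_le (by linarith) hb)
  · obtain ⟨m, hm, hmlt⟩ := Submodule.Quotient.norm_mk_lt
      (Submodule.Quotient.mk f : BanachUltraproduct U X) hε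
    refine le_trans ?_ hmlt.le
    have hn := mem_nullFamilies.1 ((Submodule.Quotient.eq _).1 hm.symm)
    have h2 : Tendsto (fun i => ‖m‖ + ‖(f - m) i‖) U (𝓝 (‖m‖ + 0)) := hn.const_add _
    rw [add_zero] at h2
    refine le_of_tendsto_of_tendsto' h h2 fun i => ?_
    calc ‖f i‖ = ‖m i + (f - m) i‖ := by simp
      _ ≤ ‖m i‖ + ‖(f - m) i‖ := norm_add_le _ _
      _ ≤ ‖m‖ + ‖(f - m) i‖ := by
        gcongr
        exact lp.norm_apply_le_norm ENNReal.top_ne_zero m i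

lemma tendsto_norm_mk (f : lp X ∞) : Tendsto (fun i => ‖f i‖) U
    (𝓝 ‖(Submodule.Quotient.mk f : BanachUltraproduct U X)‖) := by
  have hmem : ∀ i, ‖f i‖ ∈ Set.Icc 0 ‖f‖ := fun i =>
    ⟨norm_nonneg _, lp.norm_apply_le_norm ENNReal.top_ne_zero f i⟩
  obtain ⟨L, -, hL⟩ := isCompact_Icc.ultrafilter_le_nhds (U.map fun i => ‖f i‖)
    (le_principal_iff.2 (Filter.mem_map.2 (Filter.univ_mem' hmem)))
  have hL : Tendsto (fun i => ‖f i‖) U (𝓝 L) := hL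
  rwa [norm_mk_eq_of_tendsto hL]

/-- A finite-dimensional space embeds isometrically into the ultraproduct as soon as it has
asymptotically isometric linear maps to the factors. -/
lemma mem_HSet_ultraproduct {n : ℕ} {P : Mink n} (g : ∀ i, (Fin n → ℝ) →ₗ[ℝ] X i) {M : ℝ}
    (hM : ∀ i x, ‖g i x‖ ≤ M * P.out.toFun x)
    (hg : ∀ x, Tendsto (fun i => ‖g i x‖) U (𝓝 (P.out.toFun x))) :
    (⟨n, P⟩ : MinkSpace) ∈ HSet (BanachUltraproduct U X) := by
  let G : (Fin n → ℝ) →ₗ[ℝ] lp X ∞ :=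
    { toFun := fun x => ⟨fun i => g i x,
        memℓp_infty ⟨M * P.out.toFun x, by rintro _ ⟨i, rfl⟩; exact hM i x⟩⟩
      map_add' := fun x y => by ext i; exact map_add (g i) x y
      map_smul' := fun c x => by ext i; exact map_smul (g i) c x }
  exact mem_HSet_iff.2 ⟨(nullFamilies U X).mkQ ∘ₗ G, fun x => norm_mk_eq_of_tendsto (hg x)⟩

/-- A finite-dimensional subspace of the ultraproduct almost embeds into most factors. -/
lemma eventually_almost_embeds {n : ℕ} {P : Mink n}
    (hP : (⟨n, P⟩ : MinkSpace) ∈ HSet (BanachUltraproduct U X)) {r : ℝ} (hr : 1 < r) :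
    ∀ᶠ i in U, ∃ g : (Fin n → ℝ) →ₗ[ℝ] X i,
      ∀ x, P.out.toFun x ≤ ‖g x‖ ∧ ‖g x‖ ≤ r * P.out.toFun x := by
  obtain ⟨f, hf⟩ := mem_HSet_iff.1 hP
  set N := P.out
  obtain ⟨F, hF⟩ := Module.projective_lifting_property (nullFamilies U X).mkQ f
    (Submodule.mkQ_surjective _)
  let F' : N.Space →L[ℝ] lp X ∞ :=
    LinearMap.toContinuousLinearMap (F ∘ₗ N.toSpace.symm.toLinearMap)
  let g : ∀ i, N.Space →ₗ[ℝ] X i := fun i =>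
    { toFun := fun x => F' x i
      map_add' := fun x y => by simp
      map_smul' := fun c x => by simp }
  have hM : ∀ i x, ‖g i x‖ ≤ ‖F'‖ * ‖x‖ := fun i x =>
    (lp.norm_apply_le_norm ENNReal.top_ne_zero (F' x) i).trans (F'.le_opNorm x)
  have hg : ∀ x, Tendsto (fun i => ‖g i x‖) U (𝓝 ‖x‖) := fun x => by
    have h := tendsto_norm_mk (U := U) (F (N.toSpace.symm x))
    have h2 : (Submodule.Quotient.mk (F (N.toSpace.symm x)) : BanachUltraproduct U X)
        = f (N.toSpace.symm x) := LinearMap.congr_fun hF _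
    rw [h2, hf] at h
    exact h
  set ε : ℝ := (r - 1) / (r + 1) with hε
  have hε0 : 0 < ε := div_pos (by linarith) (by linarith)
  have hε1 : 0 < 1 - ε := by
    rw [hε, one_sub_div (by linarith)]
    exact div_pos (by linarith) (by linarith)
  have hεr : (1 - ε)⁻¹ * (1 + ε) = r := by
    rw [inv_mul_eq_iff_eq_mul₀ hε1.ne', hε]
    field_simp
    ring
  filter_upwards [eventually_almost_isometry g hM hg hε0] with i hi
  refine ⟨(1 - ε)⁻¹ • (g i ∘ₗ N.toSpace.toLinearMap), fun x => ?_⟩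
  have h := abs_le.1 (hi (N.toSpace x))
  rw [N.norm_toSpace] at h
  have hn : ‖((1 - ε)⁻¹ • (g i ∘ₗ N.toSpace.toLinearMap)) x‖
      = (1 - ε)⁻¹ * ‖g i (N.toSpace x)‖ := by
    simp [norm_smul, abs_of_pos hε1]
  rw [hn]
  constructor
  · rw [le_inv_mul_iff₀ hε1]
    linarith [h.1]
  · rw [← hεr, mul_assoc]
    gcongr
    linarith [h.2]

/-- Every member of the Minkowski base of `Y` embeds into an ultrapower of `Y`. -/
lemma mem_HSet_ultrapower {Y : Type*} [NormedAddCommGroup Y] [NormedSpace ℝ Y] {A : MinkSpace}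
    (hA : A ∈ closure (HSet Y)) :
    A ∈ HSet (BanachUltraproduct (hyperfilter ℕ) fun _ => Y) := by
  obtain ⟨n, P⟩ := A
  have hr : ∀ k : ℕ, (1 : ℝ) < 1 + 1 / (k + 1) := fun k => by
    have : (0 : ℝ) < 1 / (k + 1) := Nat.one_div_pos_of_nat
    linarith
  choose g hg using fun k => mem_closure_HSet_iff.1 hA _ (hr k)
  refine mem_HSet_ultraproduct g (M := 2) (fun k x => (hg k x).2.trans ?_) fun x => ?_
  · refine mul_le_mul_of_nonneg_right ?_ (P.out.nonneg x)
    have : (1 : ℝ) / (k + 1) ≤ 1 := by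
      rw [div_le_one (by positivity)]
      linarith [(Nat.cast_nonneg k : (0 : ℝ) ≤ k)]
    linarith
  · refine Tendsto.mono_left ?_ Nat.hyperfilter_le_atTop
    refine tendsto_of_tendsto_of_tendsto_of_le_of_le tendsto_const_nhds ?_
      (fun k => (hg k x).1) fun k => (hg k x).2
    have := (tendsto_one_div_add_atTop_nhds_zero_nat (𝕜 := ℝ)).const_add 1 |>.mul_const
      (P.out.toFun x)
    simpa using this

lemma mem_closure_HSet_of_ultrapower {Y : Type*} [NormedAddCommGroup Y] [NormedSpace ℝ Y]
    {A : MinkSpace} (hA : A ∈ HSet (BanachUltraproduct U fun _ => Y)) :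
    A ∈ closure (HSet Y) :=
  mem_closure_HSet_iff.2 fun _ hr => (eventually_almost_embeds hA hr).exists.choose_spec

/-- A hereditary, directed, closed, nonempty class is the set of isometry classes of
finite-dimensional subspaces of some Banach space. -/
lemma exists_banachSpace_HSet_eq {𝔑 : Set MinkSpace} (hne : 𝔑.Nonempty)
    (hH : ∀ A ∈ 𝔑, ∀ B : MinkSpace, IsSubClass B A → B ∈ 𝔑)
    (hA : ∀ A ∈ 𝔑, ∀ B ∈ 𝔑, ∃ C ∈ 𝔑, IsSubClass A C ∧ IsSubClass B C) (hC : IsClosed 𝔑) :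
    ∃ X : BanachSpace.{u}, HSet X.carrier = 𝔑 := by
  classical
  let ι : Type u := ULift.{u} 𝔑
  let E : ι → Type := fun i => (Quotient.out i.down.1.2).Space
  have htrans : ∀ {A B C : MinkSpace}, IsSubClass A B → IsSubClass B C → IsSubClass A C :=
    fun h h' => isSubClass_iff_mem_HSet.2 (h.mem_HSet (isSubClass_iff_mem_HSet.1 h'))
  let l : Filter ι := ⨅ A : 𝔑, 𝓟 {i : ι | IsSubClass A.1 i.down.1}
  have : Nonempty 𝔑 := hne.to_subtype
  have hl : l.NeBot := by
    refine iInf_neBot_of_directed' ?_ fun A => ?_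
    · intro A B
      obtain ⟨C, hC, hAC, hBC⟩ := hA A.1 A.2 B.1 B.2
      exact ⟨⟨C, hC⟩, principal_mono.2 fun i hi => htrans hAC hi,
        principal_mono.2 fun i hi => htrans hBC hi⟩
    · obtain ⟨C, hC, hAC, -⟩ := hA A.1 A.2 A.1 A.2
      exact principal_neBot_iff.2 ⟨⟨⟨C, hC⟩⟩, hAC⟩
  let U : Ultrafilter ι := Ultrafilter.of l
  refine ⟨⟨BanachUltraproduct U E⟩, Set.Subset.antisymm ?_ ?_⟩
  · rintro ⟨n, P⟩ hP
    rw [← hC.closure_eq]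
    refine mem_closure_minkSpace_iff.2 fun r hr => ?_
    obtain ⟨i, g, hg⟩ := (eventually_almost_embeds hP hr).exists
    obtain ⟨Q, hQ, hPQ⟩ := P.out.exists_near_mem_HSet g hg
    exact ⟨Q, hH i.down.1 i.down.2 _ (isSubClass_iff_mem_HSet.2 hQ), hPQ⟩
  · rintro ⟨n, P⟩ hP
    have hex : ∀ i : ι, ∃ g : (Fin n → ℝ) →ₗ[ℝ] E i, (∀ x, ‖g x‖ ≤ 1 * P.out.toFun x) ∧
        (IsSubClass ⟨n, P⟩ i.down.1 → ∀ x, ‖g x‖ = P.out.toFun x) := by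
      intro i
      by_cases h : IsSubClass ⟨n, P⟩ i.down.1
      · obtain ⟨g, hg⟩ := mem_HSet_iff.1 (isSubClass_iff_mem_HSet.1 h)
        exact ⟨g, fun x => by rw [hg, one_mul], fun _ => hg⟩
      · exact ⟨0, fun x => by simpa using P.out.nonneg x, fun h' => absurd h' h⟩
    choose g hgb hg using hex
    refine mem_HSet_ultraproduct g hgb fun x => tendsto_const_nhds.congr' ?_
    have hmem : {i : ι | IsSubClass ⟨n, P⟩ i.down.1} ∈ l :=
      mem_iInf_of_mem (⟨⟨n, P⟩, hP⟩ : 𝔑) (mem_principal_self _)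
    filter_upwards [Ultrafilter.of_le l hmem] with i hi
    exact (hg i hi x).symm

end Ultraproduct

/-- **Synthesis theorem.** A nonempty set `𝔑 ⊆ 𝔐` is the Minkowski base
`𝔐(X^f)` (the closure of `H(X)`) of some Banach space `X` iff it is hereditary (H),
directed (A₀), and closed in `𝔐` (C). -/
theorem synthesis_theorem (𝔑 : Set MinkSpace) (hne : 𝔑.Nonempty) :
    (∃ X : BanachSpace.{u}, closure (HSet X.carrier) = 𝔑) ↔
      ((∀ A ∈ 𝔑, ∀ B : MinkSpace, IsSubClass B A → B ∈ 𝔑) ∧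
       (∀ A ∈ 𝔑, ∀ B ∈ 𝔑, ∃ C ∈ 𝔑, IsSubClass A C ∧ IsSubClass B C) ∧
       IsClosed 𝔑) := by
  constructor
  · rintro ⟨X, rfl⟩
    refine ⟨fun A hA B hBA => hBA.mem_closure_HSet hA, fun A hA B hB => ?_, isClosed_closure⟩
    obtain ⟨C, hC, hAC, hBC⟩ :=
      exists_isSubClass_of_mem_HSet (mem_HSet_ultrapower hA) (mem_HSet_ultrapower hB)
    exact ⟨C, mem_closure_HSet_of_ultrapower hC, hAC, hBC⟩
  · rintro ⟨hH, hA, hC⟩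
    obtain ⟨X, hX⟩ := exists_banachSpace_HSet_eq.{u} hne hH hA hC
    exact ⟨X, by rw [hX, hC.closure_eq]⟩
end
end
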